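/- arXiv:1504.04214 — 2 statements merged into one kernel-verified Lean document; each statement's English description precedes it below -/
import Mathlib

section
/- Let f be a mixing piecewise expanding unimodal map with C² branches whose critical point c is periodic, and let ρ be the density of its unique absolutely continuous invariant probability measure. Then ρ is differentiable at every point of [0,1] except for at most finitely many points. -/
open MeasureTheory Set Filter Topology Asymptotics
open scoped ENNReal NNReal

/-- `BoundedVariationOn` on the unit interval. -/
def bvOn (φ : ℝ → ℝ) : Prop := BoundedVariationOn φ (Set.Icc 0 1)

/-- The supremum norm of `φ` over `[0,1]`. -/
noncomputable def supNorm (φ : ℝ → ℝ) : ℝ := ⨆ x : Set.Icc (0:ℝ) 1, |φ (x : ℝ)|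

/-- The total variation of `φ` over `[0,1]`, as a real number. -/
noncomputable def var01 (φ : ℝ → ℝ) : ℝ := (eVariationOn φ (Set.Icc 0 1)).toReal

/-- The BV norm `‖φ‖_BV = ‖φ‖_∞ + var(φ)` on `[0,1]`. -/
noncomputable def bvNorm (φ : ℝ → ℝ) : ℝ := supNorm φ + var01 φ

/-- The BV norm with values in `ℝ≥0∞` (no junk values). -/
noncomputable def eBVnorm (φ : ℝ → ℝ) : ℝ≥0∞ :=
  (⨆ x : Set.Icc (0:ℝ) 1, (‖φ (x : ℝ)‖₊ : ℝ≥0∞)) + eVariationOn φ (Set.Icc 0 1)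

/-- The Heaviside-type function `H_a` with value `1` left of `a`, `1/2` at `a`, `0` right of `a`. -/
noncomputable def Hstep (a x : ℝ) : ℝ := if x < a then 1 else if x = a then 1/2 else 0

/-- A piecewise expanding unimodal map (PEUM) of `[0,1]`: a map `f` with critical point
`c ∈ (0,1)` whose two branches `f₁` (on `[0, c+ε]`) and `f₂` (on `[c-ε, 1]`) are `C²` and
satisfy `|Df_j| ≥ λ > 1`. -/
structure PEUM where
  f : ℝ → ℝ
  c : ℝ
  eps : ℝ
  lam : ℝ
  f₁ : ℝ → ℝ
  f₂ : ℝ → ℝ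
  mapsTo : Set.MapsTo f (Set.Icc (0:ℝ) 1) (Set.Icc (0:ℝ) 1)
  c_mem : c ∈ Set.Ioo (0:ℝ) 1
  eps_pos : 0 < eps
  lam_gt_one : 1 < lam
  smooth₁ : ContDiffOn ℝ 2 f₁ (Set.Icc 0 (c + eps))
  smooth₂ : ContDiffOn ℝ 2 f₂ (Set.Icc (c - eps) 1)
  eq₁ : ∀ x ∈ Set.Icc (0:ℝ) 1, x ≤ c → f x = f₁ x
  eq₂ : ∀ x ∈ Set.Icc (0:ℝ) 1, c ≤ x → f x = f₂ x
  branch_eq : f₁ c = f₂ c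
  expand₁ : ∀ x ∈ Set.Icc 0 (c + eps), lam ≤ |deriv f₁ x|
  expand₂ : ∀ x ∈ Set.Icc (c - eps) 1, lam ≤ |deriv f₂ x|

namespace PEUM

/-- Both branches of `P` are of class `C^r`. -/
def BranchSmooth (P : PEUM) (r : ℕ) : Prop :=
  ContDiffOn ℝ r P.f₁ (Set.Icc 0 (P.c + P.eps)) ∧
  ContDiffOn ℝ r P.f₂ (Set.Icc (P.c - P.eps) 1)

/-- The weighted transfer operator `𝓛_m φ(x) = Σ_{f(y)=x} φ(y)/((Df(y))^m |Df(y)|)`,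
the sum ranging over preimages `y ∈ [0,1]` of `x`. -/
noncomputable def transfer (P : PEUM) (m : ℕ) (φ : ℝ → ℝ) : ℝ → ℝ := fun x =>
  ∑' y : {y : ℝ // y ∈ Set.Icc (0:ℝ) 1 ∧ P.f y = x},
    φ y.1 / ((deriv P.f y.1) ^ m * |deriv P.f y.1|)

/-- The Perron–Frobenius operator `𝓛 = 𝓛₀`. -/
noncomputable def PF (P : PEUM) : (ℝ → ℝ) → ℝ → ℝ := P.transfer 0

/-- `ξ(z) = D²f(z)/Df(z)`. -/
noncomputable def xi (P : PEUM) : ℝ → ℝ := fun z => deriv (deriv P.f) z / deriv P.f z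

/-- The measure `ρ dx` on `[0,1]`. -/
noncomputable def invMeasure (P : PEUM) (ρ : ℝ → ℝ) : Measure ℝ :=
  (volume.restrict (Set.Icc (0:ℝ) 1)).withDensity fun x => ENNReal.ofReal (ρ x)

/-- `ρ` is the (BV representative of the) density of the absolutely continuous invariant
probability measure of `P`: it is nonnegative, of bounded variation, `ρ dx` is an
`f`-invariant probability measure, and `𝓛ρ = ρ` on `[0,1]`. -/
def IsInvariantDensity (P : PEUM) (ρ : ℝ → ℝ) : Prop :=
  bvOn ρ ∧ (∀ x, 0 ≤ ρ x) ∧ IsProbabilityMeasure (P.invMeasure ρ) ∧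
    (P.invMeasure ρ).map P.f = P.invMeasure ρ ∧
    ∀ x ∈ Set.Icc (0:ℝ) 1, P.PF ρ x = ρ x

/-- Exponential mixing at rate `θ < 1`:
`𝓛ⁿh = (∫₀¹ h) ρ + O(θⁿ ‖h‖_BV)` for all `h` of bounded variation. -/
def Mixing (P : PEUM) (ρ : ℝ → ℝ) (θ : ℝ) : Prop :=
  0 < θ ∧ θ < 1 ∧ ∃ C : ℝ, 0 < C ∧ ∀ h : ℝ → ℝ, bvOn h → ∀ n : ℕ, ∀ x ∈ Set.Icc (0:ℝ) 1,
    |(P.PF)^[n] h x - (∫ z in Set.Icc (0:ℝ) 1, h z) * ρ x| ≤ C * θ ^ n * bvNorm h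

/-- `ρ₁ = −Σ_{i=1}^∞ 𝓛₁^i(ξ·ρ)` (pointwise sum of the series). -/
noncomputable def rho1 (P : PEUM) (ρ : ℝ → ℝ) : ℝ → ℝ := fun x =>
  -∑' i : ℕ, (P.transfer 1)^[i + 1] (fun y => P.xi y * ρ y) x

/-- The operator `𝔇^{i₁,…,i_k}_{m₁,…,m_k}(h₁,…,h_k)`, encoded on the list
`[(i₁,m₁,h₁),…,(i_k,m_k,h_k)]` by `𝔇((i,m,h) :: rest) = 𝓛_m^i (h · 𝔇(rest))`. -/
noncomputable def DD (P : PEUM) : List (ℕ × ℕ × (ℝ → ℝ)) → ℝ → ℝ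
  | [] => fun _ => 1
  | p :: rest => (P.transfer p.2.1)^[p.1] fun x => p.2.2 x * P.DD rest x

/-- The set `𝒩_β` of points approached exponentially fast (at rate `β`) by the critical
orbit: `|c_n − x| ≤ βⁿ` for infinitely many `n`. -/
def Nbeta (P : PEUM) (β : ℝ) : Set ℝ :=
  {x ∈ Set.Icc (0:ℝ) 1 | ∃ᶠ n in Filter.atTop, |P.f^[n] P.c - x| ≤ β ^ n}

end PEUM

/-- The sum of `w` over the preimages under `f` of a point that lie in `I`. -/
noncomputable def fiberSum (f : ℝ → ℝ) (I : Set ℝ) (w : ℝ → ℝ) (x : ℝ) : ℝ :=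
  ∑' y : {y : ℝ // y ∈ I ∧ f y = x}, w y

section FiberSum

variable {f w D : ℝ → ℝ} {I J K : Set ℝ}

theorem fiberSum_apply_of_injOn (hf : InjOn f I) {y : ℝ} (hy : y ∈ I) :
    fiberSum f I w (f y) = w y := by
  let y₀ : {z : ℝ // z ∈ I ∧ f z = f y} := ⟨y, hy, rfl⟩
  exact tsum_eq_single y₀ fun z hz => absurd (Subtype.ext (hf z.2.1 hy z.2.2)) hz

theorem fiberSum_eq_zero {x : ℝ} (h : ∀ y ∈ I, f y = x → w y = 0) : fiberSum f I w x = 0 := by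
  have : (fun y : {y : ℝ // y ∈ I ∧ f y = x} => w y) = fun _ => 0 :=
    funext fun y => h y y.2.1 y.2.2
  rw [fiberSum, this, tsum_zero]

theorem fiberSum_union {x : ℝ} (hI : {y | y ∈ I ∧ f y = x}.Finite)
    (hJ : {y | y ∈ J ∧ f y = x}.Finite) (h : ∀ y ∈ I ∩ J, f y ≠ x) :
    fiberSum f (I ∪ J) w x = fiberSum f I w x + fiberSum f J w x := by
  have hd : Disjoint {y | y ∈ I ∧ f y = x} {y | y ∈ J ∧ f y = x} :=
    Set.disjoint_left.2 fun y hy hy' => h y ⟨hy.1, hy'.1⟩ hy.2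
  have hu : {y | y ∈ I ∪ J ∧ f y = x} = {y | y ∈ I ∧ f y = x} ∪ {y | y ∈ J ∧ f y = x} := by
    ext y; simp only [mem_ofPred_eq, mem_union]; tauto
  have := hI.to_subtype
  have := hJ.to_subtype
  have key := Summable.tsum_union_disjoint (f := w) hd (Summable.of_finite ..) (Summable.of_finite ..)
  rw [← hu] at key
  exact key

theorem hasDerivAt_fiberSum (hI : IsCompact I) (hfc : ContinuousOn f I) (hf : InjOn f I)
    (hK : IsClosed K) (hw : ∀ y ∉ K, w y = 0) (hD : ∀ y ∉ K, D y = 0) {x : ℝ}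
    (h : ∀ y ∈ I ∩ K, f y = x → I ∈ 𝓝 y ∧ HasStrictDerivAt f (deriv f y) y ∧ deriv f y ≠ 0 ∧
      HasDerivAt w (D y * deriv f y) y) :
    HasDerivAt (fiberSum f I w) (fiberSum f I D x) x := by
  by_cases hx : ∃ y ∈ I ∩ K, f y = x
  · obtain ⟨y, hy, rfl⟩ := hx
    obtain ⟨hIy, hfy, hne, hwy⟩ := h y hy rfl
    rw [fiberSum_apply_of_injOn hf hy.1]
    set g := hfy.localInverse f _ y hne with hg
    have hgd : HasDerivAt g (deriv f y)⁻¹ (f y) := (hfy.to_localInverse hne).hasDerivAt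
    have hgy : g (f y) = y := HasStrictFDerivAt.localInverse_apply_image _
    have hr : ∀ᶠ z in 𝓝 (f y), f (g z) = z := HasStrictFDerivAt.eventually_right_inverse _
    have hgI : ∀ᶠ z in 𝓝 (f y), g z ∈ I := hgd.continuousAt (by rwa [hgy])
    have hcomp : HasDerivAt (w ∘ g) (D y * deriv f y * (deriv f y)⁻¹) (f y) :=
      HasDerivAt.comp (f y) (by rwa [hgy]) hgd
    rw [mul_assoc, mul_inv_cancel₀ hne, mul_one] at hcomp
    refine hcomp.congr_of_eventuallyEq ?_
    filter_upwards [hr, hgI] with z hz hzI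
    conv_lhs => rw [← hz]
    exact fiberSum_apply_of_injOn hf hzI
  · push Not at hx
    have hx0 : x ∉ f '' (I ∩ K) := fun ⟨y, hy, hyx⟩ => hx y hy hyx
    have hcl : IsClosed (f '' (I ∩ K)) :=
      ((hI.inter_right hK).image_of_continuousOn (hfc.mono inter_subset_left)).isClosed
    rw [fiberSum_eq_zero fun y hy hyx => hD y fun hyK => hx y ⟨hy, hyK⟩ hyx]
    refine (hasDerivAt_const x (0 : ℝ)).congr_of_eventuallyEq ?_
    filter_upwards [hcl.isOpen_compl.mem_nhds hx0] with z hz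
    exact fiberSum_eq_zero fun y hy hyz => hw y fun hyK => hz ⟨y, ⟨hy, hyK⟩, hyz⟩

end FiberSum

theorem hasDerivAt_div_abs {u v : ℝ → ℝ} {u' v' y : ℝ} (hu : HasDerivAt u u' y)
    (hv : HasDerivAt v v' y) (h : v y ≠ 0) :
    HasDerivAt (fun z => u z / |v z|) ((u' - v' / v y * u y) / (v y * |v y|) * v y) y := by
  have := hu.div ((hasDerivAt_abs h).comp y hv) (abs_ne_zero.2 h)
  refine this.congr_deriv ?_
  rcases lt_or_gt_of_ne h with h' | h'
  · simp [abs_of_neg h', h']; field_simp; ring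
  · simp [abs_of_pos h', h']; field_simp

/-- The indicator function of an interval has bounded variation. -/
theorem boundedVariationOn_indicator_Icc {a b : ℝ} (s : Set ℝ) :
    BoundedVariationOn ((Icc a b).indicator fun _ => (1 : ℝ)) s := by
  set m : ℝ → ℝ := fun x => if x < a then 0 else if x ≤ b then 1 else 2 with hm
  have hmono : Monotone m := by
    intro x y hxy
    simp only [hm]
    split_ifs <;> linarith
  have hmb : BoundedVariationOn m s :=
    (hmono.monotoneOn s).boundedVariationOn (C := 2) fun x _ => by
      simp only [hm]; split_ifs <;> norm_num
  have hφ : LipschitzOnWith 1 (fun t : ℝ => 1 - |t - 1|) univ := by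
    refine LipschitzOnWith.of_dist_le_mul fun x _ y _ => ?_
    have := abs_abs_sub_abs_le_abs_sub (x - 1) (y - 1)
    simp only [Real.dist_eq, NNReal.coe_one, one_mul]
    rw [← abs_neg, show -(1 - |x - 1| - (1 - |y - 1|)) = |x - 1| - |y - 1| by ring,
      show x - y = x - 1 - (y - 1) by ring]
    exact this
  have := hφ.comp_boundedVariationOn (mapsTo_univ m s) hmb
  convert this using 1
  ext x
  simp only [hm, indicator_apply, mem_Icc, Function.comp]
  split_ifs <;> grind

theorem mul_sub_le_abs_sub_of_le_abs_deriv {F : ℝ → ℝ} {a b r : ℝ} (hr : 0 < r)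
    (hF : ∀ x ∈ Icc a b, r ≤ |deriv F x|) {x y : ℝ} (hx : x ∈ Icc a b) (hy : y ∈ Icc a b)
    (hxy : x < y) : r * (y - x) ≤ |F y - F x| := by
  have hd : ∀ z ∈ Icc a b, DifferentiableAt ℝ F z := fun z hz =>
    differentiableAt_of_deriv_ne_zero (abs_pos.1 (hr.trans_le (hF z hz)))
  have hs : Icc x y ⊆ Icc a b := Icc_subset_Icc hx.1 hy.2
  obtain ⟨z, hz, hzd⟩ := exists_deriv_eq_slope F hxy
    (fun z hz => (hd z (hs hz)).continuousAt.continuousWithinAt)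
    (fun z hz => (hd z (hs (Ioo_subset_Icc_self hz))).differentiableWithinAt)
  have h := hF z (hs (Ioo_subset_Icc_self hz))
  rw [hzd, abs_div, abs_of_pos (sub_pos.2 hxy), le_div_iff₀ (sub_pos.2 hxy)] at h
  exact h

theorem exists_bound_deriv_deriv {F : ℝ → ℝ} {a b : ℝ} (hab : a < b)
    (hF : ContDiffOn ℝ 2 F (Icc a b)) : ∃ M, ∀ x ∈ Ioo a b, |deriv (deriv F) x| ≤ M := by
  have hu := uniqueDiffOn_Icc hab
  have h1 : ContDiffOn ℝ 1 (derivWithin F (Icc a b)) (Icc a b) :=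
    hF.derivWithin hu (by norm_num)
  have h0 : ContDiffOn ℝ 0 (derivWithin (derivWithin F (Icc a b)) (Icc a b)) (Icc a b) :=
    h1.derivWithin hu (by norm_num)
  obtain ⟨M, hM⟩ := isCompact_Icc.exists_bound_of_continuousOn h0.continuousOn
  refine ⟨M, fun x hx => ?_⟩
  have he : derivWithin F (Icc a b) =ᶠ[𝓝 x] deriv F := by
    filter_upwards [isOpen_Ioo.mem_nhds hx] with z hz
    exact derivWithin_of_mem_nhds (Icc_mem_nhds hz.1 hz.2)
  have := hM x (Ioo_subset_Icc_self hx)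
  rwa [derivWithin_of_mem_nhds (Icc_mem_nhds hx.1 hx.2), he.deriv_eq] at this

/-- A continuous expanding unimodal map with a maximum at `c` leaves the interval between the
second and the first image of `c` invariant. -/
theorem core_of_strictMonoOn_of_strictAntiOn {f : ℝ → ℝ} {c : ℝ} (hc : c ∈ Ioo (0 : ℝ) 1)
    (hf : MapsTo f (Icc 0 1) (Icc 0 1)) (hm : StrictMonoOn f (Icc 0 c))
    (ha : StrictAntiOn f (Icc c 1))
    (h₁ : ∀ x ∈ Icc 0 c, ∀ y ∈ Icc 0 c, x < y → y - x < |f y - f x|)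
    (h₂ : ∀ x ∈ Icc c 1, ∀ y ∈ Icc c 1, x < y → y - x < |f y - f x|) :
    f (f c) < f c ∧ MapsTo f (Icc (f (f c)) (f c)) (Icc (f (f c)) (f c)) := by
  have hc0 : (0 : ℝ) ∈ Icc 0 c := ⟨le_rfl, hc.1.le⟩
  have hcc : c ∈ Icc 0 c := ⟨hc.1.le, le_rfl⟩
  have hcc' : c ∈ Icc c 1 := ⟨le_rfl, hc.2.le⟩
  have hc01 : c ∈ Icc (0 : ℝ) 1 := ⟨hc.1.le, hc.2.le⟩
  have hf0 := hf (show (0 : ℝ) ∈ Icc 0 1 by simp)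
  have hup : ∀ x ∈ Icc 0 c, x ≤ f x := by
    intro x hx
    rcases hx.1.eq_or_lt with h | h
    · rw [← h]; exact hf0.1
    · have := h₁ 0 hc0 x hx h
      rw [abs_of_pos (sub_pos.2 (hm hc0 hx h))] at this
      linarith [hf0.1]
  have hlt : c < f c := by
    have := h₁ 0 hc0 c hcc hc.1
    rw [abs_of_pos (sub_pos.2 (hm hc0 hcc hc.1))] at this
    linarith [hf0.1]
  have hfc : f c ∈ Icc c 1 := ⟨hlt.le, (hf hc01).2⟩
  have hlt' : f (f c) < c := by
    have := h₂ c hcc' (f c) hfc hlt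
    rw [abs_of_neg (sub_neg.2 (ha hcc' hfc hlt))] at this
    linarith
  refine ⟨hlt'.trans hlt, fun x hx => ?_⟩
  have h0 : 0 ≤ f (f c) := (hf (hf hc01)).1
  rcases le_total x c with h | h
  · have hx' : x ∈ Icc 0 c := ⟨h0.trans hx.1, h⟩
    exact ⟨hx.1.trans (hup x hx'), hm.monotoneOn hx' hcc h⟩
  · have hx' : x ∈ Icc c 1 := ⟨h, hx.2.trans hfc.2⟩
    exact ⟨ha.antitoneOn hx' hfc hx.2, ha.antitoneOn hcc' hx' h⟩

namespace PEUM

variable (P : PEUM)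

theorem c_mem_Icc : P.c ∈ Icc (0 : ℝ) 1 := Ioo_subset_Icc_self P.c_mem

theorem lam_pos : 0 < P.lam := one_pos.trans P.lam_gt_one

theorem Icc_subset_left : Icc 0 P.c ⊆ Icc 0 (P.c + P.eps) :=
  Icc_subset_Icc_right (by linarith [P.eps_pos])

theorem Icc_subset_right : Icc P.c 1 ⊆ Icc (P.c - P.eps) 1 :=
  Icc_subset_Icc_left (by linarith [P.eps_pos])

theorem eqOn_left : EqOn P.f P.f₁ (Icc 0 P.c) := fun x hx =>
  P.eq₁ x ⟨hx.1, hx.2.trans P.c_mem.2.le⟩ hx.2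

theorem eqOn_right : EqOn P.f P.f₂ (Icc P.c 1) := fun x hx =>
  P.eq₂ x ⟨P.c_mem.1.le.trans hx.1, hx.2⟩ hx.1

theorem continuousOn_left : ContinuousOn P.f (Icc 0 P.c) :=
  (P.smooth₁.continuousOn.mono P.Icc_subset_left).congr P.eqOn_left

theorem continuousOn_right : ContinuousOn P.f (Icc P.c 1) :=
  (P.smooth₂.continuousOn.mono P.Icc_subset_right).congr P.eqOn_right

theorem sub_lt_abs_sub_left :
    ∀ x ∈ Icc 0 P.c, ∀ y ∈ Icc 0 P.c, x < y → y - x < |P.f y - P.f x| := by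
  intro x hx y hy hxy
  rw [P.eqOn_left hx, P.eqOn_left hy]
  have := mul_sub_le_abs_sub_of_le_abs_deriv P.lam_pos P.expand₁ (P.Icc_subset_left hx)
    (P.Icc_subset_left hy) hxy
  nlinarith [P.lam_gt_one]

theorem sub_lt_abs_sub_right :
    ∀ x ∈ Icc P.c 1, ∀ y ∈ Icc P.c 1, x < y → y - x < |P.f y - P.f x| := by
  intro x hx y hy hxy
  rw [P.eqOn_right hx, P.eqOn_right hy]
  have := mul_sub_le_abs_sub_of_le_abs_deriv P.lam_pos P.expand₂ (P.Icc_subset_right hx)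
    (P.Icc_subset_right hy) hxy
  nlinarith [P.lam_gt_one]

end PEUM

theorem injOn_of_sub_lt_abs_sub {f : ℝ → ℝ} {s : Set ℝ}
    (h : ∀ x ∈ s, ∀ y ∈ s, x < y → y - x < |f y - f x|) : InjOn f s := by
  intro x hx y hy hxy
  rcases lt_trichotomy x y with h' | h' | h'
  · have := h x hx y hy h'
    simp [hxy] at this; linarith
  · exact h'
  · have := h y hy x hx h'
    simp [hxy] at this; linarith

namespace PEUM

variable (P : PEUM)

theorem injOn_left : InjOn P.f (Icc 0 P.c) := injOn_of_sub_lt_abs_sub P.sub_lt_abs_sub_left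

theorem injOn_right : InjOn P.f (Icc P.c 1) := injOn_of_sub_lt_abs_sub P.sub_lt_abs_sub_right

/-- The interval spanned by the first two images of the critical point is non-degenerate
and forward invariant. -/
theorem exists_core : ∃ a b : ℝ, a < b ∧ a ∈ range (fun k => P.f^[k] P.c) ∧
    b ∈ range (fun k => P.f^[k] P.c) ∧ MapsTo P.f (Icc a b) (Icc a b) := by
  have hc1 : P.f P.c ∈ range (fun k => P.f^[k] P.c) := ⟨1, rfl⟩
  have hc2 : P.f (P.f P.c) ∈ range (fun k => P.f^[k] P.c) := ⟨2, rfl⟩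
  have h0 := P.mapsTo (show (0 : ℝ) ∈ Icc 0 1 by simp)
  have h1 := P.mapsTo (show (1 : ℝ) ∈ Icc 0 1 by simp)
  have hc := P.c_mem
  have m0 : (0 : ℝ) ∈ Icc 0 P.c := ⟨le_rfl, hc.1.le⟩
  have mc : P.c ∈ Icc 0 P.c := ⟨hc.1.le, le_rfl⟩
  have mc' : P.c ∈ Icc P.c 1 := ⟨le_rfl, hc.2.le⟩
  have m1 : (1 : ℝ) ∈ Icc P.c 1 := ⟨hc.2.le, le_rfl⟩
  have e1 := P.sub_lt_abs_sub_left 0 m0 P.c mc hc.1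
  have e2 := P.sub_lt_abs_sub_right P.c mc' 1 m1 hc.2
  rcases P.continuousOn_left.strictMonoOn_of_injOn_Icc' hc.1.le P.injOn_left with hl | hl <;>
  rcases P.continuousOn_right.strictMonoOn_of_injOn_Icc' hc.2.le P.injOn_right with hr | hr
  · rw [abs_of_pos (sub_pos.2 (hl m0 mc hc.1))] at e1
    rw [abs_of_pos (sub_pos.2 (hr mc' m1 hc.2))] at e2
    linarith [h0.1, h1.2]
  · obtain ⟨h, hm⟩ := core_of_strictMonoOn_of_strictAntiOn hc P.mapsTo hl hr
      P.sub_lt_abs_sub_left P.sub_lt_abs_sub_right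
    exact ⟨_, _, h, hc2, hc1, hm⟩
  · obtain ⟨h, hm⟩ := core_of_strictMonoOn_of_strictAntiOn (f := fun x => 1 - P.f (1 - x))
      (c := 1 - P.c) ⟨by linarith [hc.2], by linarith [hc.1]⟩
      (fun x hx => by
        have := P.mapsTo (show 1 - x ∈ Icc (0 : ℝ) 1 from ⟨by linarith [hx.2], by linarith [hx.1]⟩)
        exact ⟨by linarith [this.2], by linarith [this.1]⟩)
      (fun x hx y hy hxy => by
        have := hr (show 1 - y ∈ Icc P.c 1 from ⟨by linarith [hy.2], by linarith [hy.1]⟩)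
          (show 1 - x ∈ Icc P.c 1 from ⟨by linarith [hx.2], by linarith [hx.1]⟩) (by linarith)
        dsimp only; linarith)
      (fun x hx y hy hxy => by
        have := hl (show 1 - y ∈ Icc 0 P.c from ⟨by linarith [hy.2], by linarith [hy.1]⟩)
          (show 1 - x ∈ Icc 0 P.c from ⟨by linarith [hx.2], by linarith [hx.1]⟩) (by linarith)
        dsimp only; linarith)
      (fun x hx y hy hxy => by
        have := P.sub_lt_abs_sub_right (1 - y) ⟨by linarith [hy.2], by linarith [hy.1]⟩
          (1 - x) ⟨by linarith [hx.2], by linarith [hx.1]⟩ (by linarith)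
        ring_nf at this ⊢; linarith)
      (fun x hx y hy hxy => by
        have := P.sub_lt_abs_sub_left (1 - y) ⟨by linarith [hy.2], by linarith [hy.1]⟩
          (1 - x) ⟨by linarith [hx.2], by linarith [hx.1]⟩ (by linarith)
        ring_nf at this ⊢; linarith)
    simp only [sub_sub_cancel] at h hm
    refine ⟨_, _, by linarith, hc1, hc2, fun x hx => ?_⟩
    have := hm (show 1 - x ∈ Icc (1 - P.f (P.f P.c)) (1 - P.f P.c) from
      ⟨by linarith [hx.2], by linarith [hx.1]⟩)
    simp only [sub_sub_cancel] at this
    exact ⟨by linarith [this.2], by linarith [this.1]⟩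
  · rw [abs_of_neg (sub_neg.2 (hl m0 mc hc.1))] at e1
    rw [abs_of_neg (sub_neg.2 (hr mc' m1 hc.2))] at e2
    linarith [h0.2, h1.1]

theorem abs_deriv_eq_zero_or_le {y : ℝ} (hy : y ∈ Icc (0 : ℝ) 1) :
    deriv P.f y = 0 ∨ P.lam ≤ |deriv P.f y| := by
  by_cases hd : DifferentiableAt ℝ P.f y
  swap
  · exact Or.inl (deriv_zero_of_not_differentiableAt hd)
  right
  have key : ∀ {a b : ℝ} {F : ℝ → ℝ}, a < b → y ∈ Icc a b → EqOn P.f F (Icc a b) →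
      P.lam ≤ |deriv F y| → P.lam ≤ |deriv P.f y| := by
    intro a b F hab hyab he hF
    have hu := uniqueDiffOn_Icc hab y hyab
    have hFd : DifferentiableAt ℝ F y :=
      differentiableAt_of_deriv_ne_zero (abs_pos.1 (P.lam_pos.trans_le hF))
    rwa [← hd.derivWithin hu, derivWithin_congr he (he hyab), hFd.derivWithin hu]
  rcases le_total y P.c with h | h
  · exact key P.c_mem.1 ⟨hy.1, h⟩ P.eqOn_left (P.expand₁ y (P.Icc_subset_left ⟨hy.1, h⟩))
  · exact key P.c_mem.2 ⟨h, hy.2⟩ P.eqOn_right (P.expand₂ y (P.Icc_subset_right ⟨h, hy.2⟩))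

theorem contDiffAt {y : ℝ} (hy : y ∈ Ioo (0 : ℝ) 1) (hyc : y ≠ P.c) : ContDiffAt ℝ 2 P.f y := by
  rcases lt_or_gt_of_ne hyc with h | h
  · refine (P.smooth₁.contDiffAt (Icc_mem_nhds hy.1 (by linarith [P.eps_pos]))).congr_of_eventuallyEq
      ?_
    filter_upwards [Icc_mem_nhds hy.1 h] with z hz using P.eqOn_left hz
  · refine (P.smooth₂.contDiffAt (Icc_mem_nhds (by linarith [P.eps_pos]) hy.2)).congr_of_eventuallyEq
      ?_
    filter_upwards [Icc_mem_nhds h hy.2] with z hz using P.eqOn_right hz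

theorem deriv_ne_zero {y : ℝ} (hy : y ∈ Ioo (0 : ℝ) 1) (hyc : y ≠ P.c) : deriv P.f y ≠ 0 := by
  rcases lt_or_gt_of_ne hyc with h | h
  · have he : P.f =ᶠ[𝓝 y] P.f₁ := by
      filter_upwards [Icc_mem_nhds hy.1 h] with z hz using P.eqOn_left hz
    rw [he.deriv_eq]
    exact abs_pos.1 (P.lam_pos.trans_le (P.expand₁ y (P.Icc_subset_left ⟨hy.1.le, h.le⟩)))
  · have he : P.f =ᶠ[𝓝 y] P.f₂ := by
      filter_upwards [Icc_mem_nhds h hy.2] with z hz using P.eqOn_right hz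
    rw [he.deriv_eq]
    exact abs_pos.1 (P.lam_pos.trans_le (P.expand₂ y (P.Icc_subset_right ⟨h.le, hy.2.le⟩)))

theorem exists_bound_xi : ∃ M, 0 ≤ M ∧ ∀ y ∈ Ioo (0 : ℝ) 1, y ≠ P.c → |P.xi y| ≤ M := by
  obtain ⟨M₁, hM₁⟩ := exists_bound_deriv_deriv (by linarith [P.c_mem.1, P.eps_pos]) P.smooth₁
  obtain ⟨M₂, hM₂⟩ := exists_bound_deriv_deriv (by linarith [P.c_mem.2, P.eps_pos]) P.smooth₂
  refine ⟨max 0 (max M₁ M₂), le_max_left _ _, fun y hy hyc => ?_⟩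
  have hone : 1 ≤ |deriv P.f y| := P.lam_gt_one.le.trans
    ((P.abs_deriv_eq_zero_or_le (Ioo_subset_Icc_self hy)).resolve_left (P.deriv_ne_zero hy hyc))
  refine (abs_div _ _).trans_le ((div_le_self (abs_nonneg _) hone).trans ?_)
  rcases lt_or_gt_of_ne hyc with h | h
  · have he : P.f =ᶠ[𝓝 y] P.f₁ := by
      filter_upwards [Icc_mem_nhds hy.1 h] with z hz using P.eqOn_left hz
    rw [he.deriv.deriv_eq]
    exact (hM₁ y ⟨hy.1, by linarith [P.eps_pos]⟩).trans (by simp)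
  · have he : P.f =ᶠ[𝓝 y] P.f₂ := by
      filter_upwards [Icc_mem_nhds h hy.2] with z hz using P.eqOn_right hz
    rw [he.deriv.deriv_eq]
    exact (hM₂ y ⟨by linarith [P.eps_pos], hy.2⟩).trans (by simp)

theorem finite_fiber_left (x : ℝ) : {y | y ∈ Icc 0 P.c ∧ P.f y = x}.Finite :=
  Set.Subsingleton.finite fun _ hy _ hz => P.injOn_left hy.1 hz.1 (hy.2.trans hz.2.symm)

theorem finite_fiber_right (x : ℝ) : {y | y ∈ Icc P.c 1 ∧ P.f y = x}.Finite :=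
  Set.Subsingleton.finite fun _ hy _ hz => P.injOn_right hy.1 hz.1 (hy.2.trans hz.2.symm)

theorem finite_fiber (x : ℝ) : {y | y ∈ Icc (0 : ℝ) 1 ∧ P.f y = x}.Finite := by
  refine ((P.finite_fiber_left x).union (P.finite_fiber_right x)).subset fun y hy => ?_
  exact (le_total y P.c).imp (fun h => ⟨⟨hy.1.1, h⟩, hy.2⟩) (fun h => ⟨⟨h, hy.1.2⟩, hy.2⟩)

instance (x : ℝ) : Finite {y : ℝ // y ∈ Icc (0 : ℝ) 1 ∧ P.f y = x} :=
  (P.finite_fiber x).to_subtype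

/-- The weighted transfer operator as a linear map. -/
noncomputable def transferLinear (m : ℕ) : (ℝ → ℝ) →ₗ[ℝ] ℝ → ℝ where
  toFun := P.transfer m
  map_add' φ ψ := by
    ext x
    simp only [transfer, Pi.add_apply, add_div]
    exact Summable.tsum_add .of_finite .of_finite
  map_smul' r φ := by
    ext x
    simp only [transfer, Pi.smul_apply, smul_eq_mul, mul_div_assoc, RingHom.id_apply]
    exact tsum_mul_left

@[simp] theorem transferLinear_apply (m : ℕ) (φ : ℝ → ℝ) :
    P.transferLinear m φ = P.transfer m φ := rfl

theorem transfer_eq_zero {K : Set ℝ} (hK : MapsTo P.f K K) {m : ℕ} {φ : ℝ → ℝ}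
    (hφ : ∀ y ∉ K, φ y = 0) : ∀ x ∉ K, P.transfer m φ x = 0 := fun x hx =>
  fiberSum_eq_zero (f := P.f) (I := Icc 0 1)
    (w := fun y => φ y / ((deriv P.f y) ^ m * |deriv P.f y|)) fun y _ hyx => by
      rw [hφ y fun h => hx (hyx ▸ hK h), zero_div]

theorem abs_transfer_one_le {φ G : ℝ → ℝ} (h : ∀ y ∈ Icc (0 : ℝ) 1, |φ y| ≤ G y) (x : ℝ) :
    |P.transfer 1 φ x| ≤ P.lam⁻¹ * P.PF G x := by
  rw [PF, transfer, transfer, ← tsum_mul_left]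
  have hsum : ∀ F : {y : ℝ // y ∈ Icc (0 : ℝ) 1 ∧ P.f y = x} → ℝ, Summable F :=
    fun _ => .of_finite
  refine (Real.norm_eq_abs _).symm.trans_le <| (norm_tsum_le_tsum_norm (hsum _)).trans
    (Summable.tsum_le_tsum (fun y => ?_) (hsum _) (hsum _))
  have hy := h y y.2.1
  rw [Real.norm_eq_abs, abs_div, abs_mul, abs_abs, pow_one, pow_zero, one_mul]
  rcases P.abs_deriv_eq_zero_or_le y.2.1 with h0 | h0
  · simp [h0]
  · have hpos := P.lam_pos.trans_le h0
    rw [mul_comm P.lam⁻¹, ← div_eq_mul_inv, div_div]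
    exact div_le_div₀ ((abs_nonneg _).trans hy) hy (mul_pos hpos P.lam_pos)
      (mul_le_mul_of_nonneg_left h0 hpos.le)

theorem exists_summable_bound_of_transfer {e w : ℕ → ℝ → ℝ} {A B θ : ℝ} (hθ : θ < 1)
    (hθ₀ : 0 < θ) (hA : 0 ≤ A)
    (hB : ∀ n, ∀ x ∈ Icc (0 : ℝ) 1, (P.PF)^[n] 1 x ≤ B)
    (he₀ : ∀ x ∈ Icc (0 : ℝ) 1, |e 0 x| ≤ A) (he : ∀ n, e (n + 1) = P.transfer 1 (w n))
    (hw : ∀ n, ∀ x ∈ Icc (0 : ℝ) 1, |w n x| ≤ |e n x| + A * θ ^ n) :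
    ∃ a : ℕ → ℝ, Summable a ∧ ∀ n, ∀ x ∈ Icc (0 : ℝ) 1, |e n x| ≤ a n := by
  set σ := max P.lam⁻¹ θ with hσ
  have hσ0 : 0 < σ := hθ₀.trans_le (le_max_right _ _)
  have hσ1 : σ < 1 := max_lt (inv_lt_one_of_one_lt₀ P.lam_gt_one) hθ
  let G : ℕ → ℝ → ℝ := fun n =>
    A • ((P.PF)^[n] 1 + ∑ k ∈ Finset.range n, (P.PF)^[k + 1] 1)
  have hG : ∀ n, P.PF (G n + A • (1 : ℝ → ℝ)) = G (n + 1) := by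
    intro n
    change P.transferLinear 0 _ = _
    simp only [G, map_add, map_smul, map_sum, transferLinear_apply]
    rw [Finset.sum_range_succ']
    simp only [Function.iterate_succ_apply', Function.iterate_zero, id, PF, smul_add]
    rw [add_assoc]
  have hbound : ∀ n, ∀ x ∈ Icc (0 : ℝ) 1, |e n x| ≤ σ ^ n * G n x := by
    intro n
    induction n with
    | zero => intro x hx; simpa [G] using he₀ x hx
    | succ n ih =>
      intro x hx
      have h1 := P.abs_transfer_one_le (φ := w n) (G := σ ^ n • (G n + A • (1 : ℝ → ℝ)))
        (fun y hy => by
          have hpow : θ ^ n ≤ σ ^ n := pow_le_pow_left₀ hθ₀.le (le_max_right _ _) n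
          have := mul_le_mul_of_nonneg_left hpow hA
          have := ih y hy
          have := hw n y hy
          simp only [Pi.smul_apply, Pi.add_apply, smul_eq_mul, Pi.one_apply]
          linarith) x
      have h2 : P.PF (σ ^ n • (G n + A • (1 : ℝ → ℝ))) = σ ^ n • G (n + 1) := by
        rw [← hG]; exact (P.transferLinear 0).map_smul _ _
      rw [h2, ← he, Pi.smul_apply, smul_eq_mul] at h1
      have h3 : 0 ≤ σ ^ n * G (n + 1) x :=
        nonneg_of_mul_nonneg_right ((abs_nonneg _).trans h1) (inv_pos.2 P.lam_pos)
      calc |e (n + 1) x| ≤ P.lam⁻¹ * (σ ^ n * G (n + 1) x) := h1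
        _ ≤ σ * (σ ^ n * G (n + 1) x) := mul_le_mul_of_nonneg_right (le_max_left _ _) h3
        _ = σ ^ (n + 1) * G (n + 1) x := by ring
  refine ⟨fun n => σ ^ n * (A * (B + n * B)), ?_, fun n x hx => (hbound n x hx).trans ?_⟩
  · have hσn : ‖σ‖ < 1 := by rwa [Real.norm_eq_abs, abs_of_pos hσ0]
    have s1 := (summable_pow_mul_geometric_of_norm_lt_one 1 hσn).mul_left (A * B)
    have s0 := (summable_pow_mul_geometric_of_norm_lt_one 0 hσn).mul_left (A * B)
    refine (s0.add s1).congr fun n => ?_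
    ring
  · refine mul_le_mul_of_nonneg_left ?_ (pow_nonneg hσ0.le n)
    simp only [G, Pi.smul_apply, Pi.add_apply, smul_eq_mul, Finset.sum_apply]
    refine mul_le_mul_of_nonneg_left (add_le_add (hB n x hx) ?_) hA
    refine (Finset.sum_le_card_nsmul _ _ B fun k _ => hB (k + 1) x hx).trans ?_
    simp

/-- The function `ξ`, set to zero where its value depends on junk values of derivatives. -/
noncomputable def interiorXi : ℝ → ℝ := (Ioo (0 : ℝ) 1 \ {P.c}).indicator P.xi

theorem exists_abs_interiorXi_le : ∃ M, 0 ≤ M ∧ ∀ y, |P.interiorXi y| ≤ M := by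
  obtain ⟨M, hM0, hM⟩ := P.exists_bound_xi
  refine ⟨M, hM0, fun y => ?_⟩
  rw [interiorXi, indicator_apply]
  split_ifs with h
  · exact hM y h.1 h.2
  · simpa using hM0

/-- The derivative of `𝓛u` is `𝓛₁(u' - ξu)` away from a forward invariant set containing `c`. -/
theorem hasDerivAt_PF {K S : Set ℝ} (hK : IsClosed K) (hSc : P.c ∈ S)
    (hS : ∀ y ∈ S, P.f y ∈ S) (h0 : 0 ∈ K → 0 ∈ S) (h1 : 1 ∈ K → 1 ∈ S) {u d : ℝ → ℝ}
    (hu : ∀ y ∉ K, u y = 0) (hd : ∀ y ∉ K, d y = 0)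
    (hud : ∀ y ∈ Ioo (0 : ℝ) 1 \ S, HasDerivAt u (d y) y) {x : ℝ} (hx : x ∉ S) :
    HasDerivAt (P.PF u) (P.transfer 1 (fun y => d y - P.interiorXi y * u y) x) x := by
  have hunion : Icc (0 : ℝ) 1 = Icc 0 P.c ∪ Icc P.c 1 :=
    (Icc_union_Icc_eq_Icc P.c_mem.1.le P.c_mem.2.le).symm
  have hsplit : ∀ (w : ℝ → ℝ) (z : ℝ), z ≠ P.f P.c → fiberSum P.f (Icc 0 1) w z =
      fiberSum P.f (Icc 0 P.c) w z + fiberSum P.f (Icc P.c 1) w z := by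
    intro w z hz
    rw [hunion]
    refine fiberSum_union (P.finite_fiber_left z) (P.finite_fiber_right z) fun y hy hyz => hz ?_
    rw [← hyz, le_antisymm hy.1.2 hy.2.1]
  have hxc : x ≠ P.f P.c := fun h => hx (h ▸ hS _ hSc)
  set w : ℝ → ℝ := fun y => u y / |deriv P.f y| with hw_def
  set D : ℝ → ℝ := fun y => (d y - P.interiorXi y * u y) / (deriv P.f y * |deriv P.f y|)
    with hD_def
  have hw : ∀ y ∉ K, w y = 0 := fun y hy => by simp [hw_def, hu y hy]
  have hD : ∀ y ∉ K, D y = 0 := fun y hy => by simp [hD_def, hu y hy, hd y hy]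
  have hPF : P.PF u = fiberSum P.f (Icc 0 1) w := by
    funext z; simp [PF, transfer, fiberSum, hw_def]
  have hT : P.transfer 1 (fun y => d y - P.interiorXi y * u y) = fiberSum P.f (Icc 0 1) D := by
    funext z; simp [transfer, fiberSum, hD_def]
  have hlocal : ∀ y ∈ Ioo (0 : ℝ) 1, P.f y = x → HasStrictDerivAt P.f (deriv P.f y) y ∧
      deriv P.f y ≠ 0 ∧ HasDerivAt w (D y * deriv P.f y) y := by
    intro y hy hyx
    have hyS : y ∉ S := fun h => hx (hyx ▸ hS y h)
    have hyc : y ≠ P.c := fun h => hyS (h ▸ hSc)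
    have hf := P.contDiffAt hy hyc
    have hne := P.deriv_ne_zero hy hyc
    refine ⟨hf.hasStrictDerivAt (by norm_num), hne, ?_⟩
    have hff : HasDerivAt (deriv P.f) (deriv (deriv P.f) y) y :=
      ((ContDiffAt.derivWithin (m := 1) hf (by norm_num)).differentiableAt (by norm_num)).hasDerivAt
    have hxi : P.interiorXi y = deriv (deriv P.f) y / deriv P.f y :=
      indicator_of_mem (show y ∈ Ioo (0 : ℝ) 1 \ {P.c} from ⟨hy, hyc⟩) _
    have := hasDerivAt_div_abs (hud y ⟨hy, hyS⟩) hff hne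
    rwa [← hxi] at this
  have hne : ∀ y, P.f y = x → y ≠ P.c := fun y hyx h => hxc (h ▸ hyx.symm)
  have hleft : HasDerivAt (fiberSum P.f (Icc 0 P.c) w) (fiberSum P.f (Icc 0 P.c) D x) x := by
    refine hasDerivAt_fiberSum isCompact_Icc P.continuousOn_left P.injOn_left hK hw hD
      fun y hy hyx => ?_
    have hy0 : 0 < y := hy.1.1.lt_of_ne fun h => hx (hyx ▸ hS y (h ▸ h0 (h ▸ hy.2)))
    have hyc : y < P.c := hy.1.2.lt_of_ne (hne y hyx)
    exact ⟨Icc_mem_nhds hy0 hyc, hlocal y ⟨hy0, hyc.trans P.c_mem.2⟩ hyx⟩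
  have hright : HasDerivAt (fiberSum P.f (Icc P.c 1) w) (fiberSum P.f (Icc P.c 1) D x) x := by
    refine hasDerivAt_fiberSum isCompact_Icc P.continuousOn_right P.injOn_right hK hw hD
      fun y hy hyx => ?_
    have hy1 : y < 1 := hy.1.2.lt_of_ne fun h => hx (hyx ▸ hS y (h ▸ h1 (h ▸ hy.2)))
    have hyc : P.c < y := hy.1.1.lt_of_ne (hne y hyx).symm
    exact ⟨Icc_mem_nhds hyc hy1, hlocal y ⟨P.c_mem.1.trans hyc, hy1⟩ hyx⟩
  rw [hPF, hT, hsplit D x hxc]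
  refine (hleft.add hright).congr_of_eventuallyEq ?_
  filter_upwards [isOpen_ne.mem_nhds hxc] with z hz using hsplit w z hz

/-- The derivatives of `𝓛ⁿh`, for `h` locally constant away from the singular set. -/
noncomputable def derivSeq (h : ℝ → ℝ) : ℕ → ℝ → ℝ
  | 0 => 0
  | n + 1 => P.transfer 1 fun y => derivSeq h n y - P.interiorXi y * (P.PF)^[n] h y

theorem exists_uniform_limit_derivSeq {ρ : ℝ → ℝ} {θ : ℝ} (hmix : P.Mixing ρ θ) {h : ℝ → ℝ}
    (hh : bvOn h) : ∃ D : ℝ → ℝ, TendstoUniformlyOn (P.derivSeq h) D atTop (Icc 0 1) := by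
  obtain ⟨hθ₀, hθ, C, hC, hmix⟩ := hmix
  obtain ⟨M, hM0, hM⟩ := P.exists_abs_interiorXi_le
  have hone : bvOn (1 : ℝ → ℝ) :=
    (monotone_const.monotoneOn _).boundedVariationOn (C := 1) (f := fun _ : ℝ => (1 : ℝ)) (by simp)
  set I : ℝ := ∫ z in Icc (0 : ℝ) 1, (1 : ℝ → ℝ) z
  have hI : I = 1 := by simp [I]
  set N := |bvNorm 1|
  have hN : ∀ n, ∀ x ∈ Icc (0 : ℝ) 1, |(P.PF)^[n] 1 x - ρ x| ≤ C * N := by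
    intro n x hx
    have := hmix 1 hone n x hx
    rw [show (∫ z in Icc (0 : ℝ) 1, (1 : ℝ → ℝ) z) = 1 from hI, one_mul] at this
    refine this.trans ?_
    have h1 : C * θ ^ n ≤ C := mul_le_of_le_one_right hC.le (pow_le_one₀ hθ₀.le hθ.le)
    exact (mul_le_mul_of_nonneg_left (le_abs_self _) (by positivity)).trans
      (mul_le_mul_of_nonneg_right h1 (abs_nonneg _))
  set B := 1 + 2 * (C * N)
  have hB : ∀ n, ∀ x ∈ Icc (0 : ℝ) 1, (P.PF)^[n] 1 x ≤ B := by
    intro n x hx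
    have h1 := abs_le.1 (hN n x hx)
    have h2 := abs_le.1 (hN 0 x hx)
    simp only [Function.iterate_zero, id, Pi.one_apply] at h2
    simp only [B]
    linarith [h1.2, h2.1]
  set H := |bvNorm h|
  have hδ : ∀ n, ∀ x ∈ Icc (0 : ℝ) 1,
      |(P.PF)^[n + 1] h x - (P.PF)^[n] h x| ≤ 2 * C * H * θ ^ n := by
    intro n x hx
    have h0 := hmix h hh n x hx
    have h1 := hmix h hh (n + 1) x hx
    have h2 : C * θ ^ n * bvNorm h ≤ C * θ ^ n * H :=
      mul_le_mul_of_nonneg_left (le_abs_self _) (by positivity)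
    have h3 : C * θ ^ (n + 1) * bvNorm h ≤ C * θ ^ n * H :=
      (mul_le_mul_of_nonneg_left (le_abs_self _) (by positivity)).trans
        (mul_le_mul_of_nonneg_right
          (mul_le_mul_of_nonneg_left (pow_le_pow_of_le_one hθ₀.le hθ.le n.le_succ) hC.le)
          (abs_nonneg _))
    rw [abs_le] at h0 h1 ⊢
    constructor <;> linarith [h0.1, h0.2, h1.1, h1.2]
  obtain ⟨R, hR⟩ : ∃ R, ∀ x ∈ Icc (0 : ℝ) 1, |h x| ≤ R := by
    refine ⟨|h 0| + (eVariationOn h (Icc 0 1)).toReal, fun x hx => ?_⟩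
    have h1 := hh.dist_le hx (show (0 : ℝ) ∈ Icc 0 1 by simp)
    rw [Real.dist_eq] at h1
    linarith [abs_sub_abs_le_abs_sub (h x) (h 0)]
  have hR0 : 0 ≤ R := (abs_nonneg _).trans (hR 0 (by simp))
  have hB0 : 0 ≤ B := by positivity
  set A := P.lam⁻¹ * (M * R * B) + M * (2 * C * H)
  have hlam := P.lam_pos
  have hA1 : 0 ≤ P.lam⁻¹ * (M * R * B) := by positivity
  have hA2 : 0 ≤ M * (2 * C * H) := by positivity
  obtain ⟨a, ha, hbound⟩ := P.exists_summable_bound_of_transfer (A := A)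
    (e := fun n => P.derivSeq h (n + 1) - P.derivSeq h n)
    (w := fun n y => (P.derivSeq h (n + 1) y - P.derivSeq h n y) -
      P.interiorXi y * ((P.PF)^[n + 1] h y - (P.PF)^[n] h y))
    hθ hθ₀ (add_nonneg hA1 hA2) hB
    (fun x hx => by
      have h1 := P.abs_transfer_one_le
        (φ := fun y => P.derivSeq h 0 y - P.interiorXi y * (P.PF)^[0] h y)
        (G := (M * R) • (1 : ℝ → ℝ)) (fun y hy => by
          simp only [derivSeq, Function.iterate_zero, id, Pi.zero_apply, zero_sub, abs_neg, abs_mul,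
            Pi.smul_apply, Pi.one_apply, smul_eq_mul, mul_one]
          exact mul_le_mul (hM y) (hR y hy) (abs_nonneg _) hM0) x
      have h2 : P.PF ((M * R) • (1 : ℝ → ℝ)) x = M * R * P.PF 1 x :=
        congrFun ((P.transferLinear 0).map_smul _ _) x
      have h3 : M * R * P.PF 1 x ≤ M * R * B := mul_le_mul_of_nonneg_left (hB 1 x hx) (by positivity)
      rw [h2] at h1
      have h4 := h1.trans (mul_le_mul_of_nonneg_left h3 (inv_nonneg.2 hlam.le))
      have h5 : (P.derivSeq h (0 + 1) - P.derivSeq h 0) x = P.transfer 1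
          (fun y => P.derivSeq h 0 y - P.interiorXi y * (P.PF)^[0] h y) x := by
        simp [derivSeq]
      rw [h5]
      simp only [A]
      linarith)
    (fun n => by
      simp only [derivSeq, ← transferLinear_apply]
      rw [← map_sub]
      congr 1
      funext y
      simp only [Pi.sub_apply]
      ring)
    (fun n x hx => by
      refine (abs_sub _ _).trans (add_le_add le_rfl ?_)
      rw [abs_mul]
      calc |P.interiorXi x| * |(P.PF)^[n + 1] h x - (P.PF)^[n] h x|
          ≤ M * (2 * C * H * θ ^ n) := mul_le_mul (hM x) (hδ n x hx) (abs_nonneg _) hM0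
        _ = M * (2 * C * H) * θ ^ n := by ring
        _ ≤ A * θ ^ n := mul_le_mul_of_nonneg_right (by simp only [A]; linarith) (by positivity))
  refine ⟨_, (tendstoUniformlyOn_tsum_nat ha hbound).congr (Eventually.of_forall fun n x _ => ?_)⟩
  have := Finset.sum_range_sub (fun k => P.derivSeq h k x) n
  simpa [derivSeq] using this

end PEUM

/-- Corollary 4.6. For a mixing PEUM whose critical point is periodic,
the invariant density `ρ` is differentiable except at finitely many points of `[0,1]`. -/
theorem periodic_critical_point_finitely_many_nondifferentiability (P : PEUM)
    (ρ : ℝ → ℝ) (θ : ℝ) (hρ : P.IsInvariantDensity ρ) (hmix : P.Mixing ρ θ)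
    (hper : ∃ p : ℕ, 1 ≤ p ∧ P.f^[p] P.c = P.c) :
    {x ∈ Set.Icc (0:ℝ) 1 | ¬ DifferentiableAt ℝ ρ x}.Finite := by
  obtain ⟨p, hp1, hp⟩ := hper
  obtain ⟨a, b, hab, haS, hbS, hmaps⟩ := P.exists_core
  set S : Set ℝ := range fun k => P.f^[k] P.c with hS_def
  have hSfin : S.Finite := by
    refine ((Finset.range p).finite_toSet.image fun k => P.f^[k] P.c).subset ?_
    rintro _ ⟨k, rfl⟩
    exact ⟨k % p, by simpa using Nat.mod_lt k hp1, Function.IsPeriodicPt.iterate_mod_apply hp k⟩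
  have hSc : P.c ∈ S := ⟨0, rfl⟩
  have hSf : ∀ y ∈ S, P.f y ∈ S := by
    rintro _ ⟨k, rfl⟩
    exact ⟨k + 1, Function.iterate_succ_apply' P.f k P.c⟩
  have hS01 : ∀ y ∈ S, y ∈ Icc (0 : ℝ) 1 := by
    rintro _ ⟨k, rfl⟩
    exact P.mapsTo.iterate k P.c_mem_Icc
  have hKsub : Icc a b ⊆ Icc 0 1 := Icc_subset_Icc (hS01 a haS).1 (hS01 b hbS).2
  set h : ℝ → ℝ := (Icc a b).indicator fun _ => 1 with h_def
  have hh : bvOn h := boundedVariationOn_indicator_Icc _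
  have hu : ∀ n, ∀ y ∉ Icc a b, (P.PF)^[n] h y = 0 := by
    intro n
    induction n with
    | zero => exact fun y hy => indicator_of_notMem hy fun _ => (1 : ℝ)
    | succ n ih => rw [Function.iterate_succ_apply']; exact P.transfer_eq_zero hmaps ih
  have hd : ∀ n, ∀ y ∉ Icc a b, P.derivSeq h n y = 0 := by
    intro n
    induction n with
    | zero => exact fun _ _ => rfl
    | succ n ih =>
      exact P.transfer_eq_zero hmaps fun y hy => by rw [ih y hy, hu n y hy, mul_zero, sub_zero]
  have h0 : (0 : ℝ) ∈ Icc a b → (0 : ℝ) ∈ S := fun hK =>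
    le_antisymm hK.1 (hS01 a haS).1 ▸ haS
  have h1 : (1 : ℝ) ∈ Icc a b → (1 : ℝ) ∈ S := fun hK =>
    le_antisymm (hS01 b hbS).2 hK.2 ▸ hbS
  have hderiv : ∀ n, ∀ x ∈ Ioo (0 : ℝ) 1 \ S,
      HasDerivAt ((P.PF)^[n] h) (P.derivSeq h n x) x := by
    intro n
    induction n with
    | zero =>
      intro x hx
      have hxa : x ≠ a := fun e => hx.2 (e ▸ haS)
      have hxb : x ≠ b := fun e => hx.2 (e ▸ hbS)
      change HasDerivAt h 0 x
      by_cases hxK : x ∈ Icc a b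
      · refine (hasDerivAt_const x (1 : ℝ)).congr_of_eventuallyEq ?_
        filter_upwards [Icc_mem_nhds (hxK.1.lt_of_ne hxa.symm) (hxK.2.lt_of_ne hxb)] with z hz
          using indicator_of_mem hz _
      · refine (hasDerivAt_const x (0 : ℝ)).congr_of_eventuallyEq ?_
        filter_upwards [isClosed_Icc.isOpen_compl.mem_nhds hxK] with z hz
          using indicator_of_notMem hz _
    | succ n ih =>
      intro x hx
      rw [Function.iterate_succ_apply']
      exact P.hasDerivAt_PF isClosed_Icc hSc hSf h0 h1 (hu n) (hd n) ih hx.2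
  obtain ⟨D, hD⟩ := P.exists_uniform_limit_derivSeq hmix hh
  obtain ⟨hθ₀, hθ, C, -, hmix⟩ := hmix
  have hint : ∫ z in Icc (0 : ℝ) 1, h z = b - a := by
    rw [h_def, setIntegral_indicator measurableSet_Icc, inter_eq_right.2 hKsub]
    simp [hab.le]
  have hlim : ∀ x ∈ Icc (0 : ℝ) 1,
      Tendsto (fun n => (P.PF)^[n] h x) atTop (𝓝 ((b - a) * ρ x)) := by
    intro x hx
    refine tendsto_iff_dist_tendsto_zero.2 (squeeze_zero (fun _ => dist_nonneg)
      (fun n => (Real.dist_eq _ _).trans_le (hint ▸ hmix h hh n x hx)) ?_)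
    simpa using ((tendsto_pow_atTop_nhds_zero_of_lt_one hθ₀.le hθ).const_mul C).mul_const (bvNorm h)
  refine ((hSfin.insert 0).insert 1).subset fun x hx => ?_
  by_contra hxn
  simp only [mem_insert_iff, not_or] at hxn
  have hxU : x ∈ Ioo (0 : ℝ) 1 \ S :=
    ⟨⟨hx.1.1.lt_of_ne (Ne.symm hxn.2.1), hx.1.2.lt_of_ne hxn.1⟩, hxn.2.2⟩
  have hsub : Ioo (0 : ℝ) 1 \ S ⊆ Icc 0 1 := sdiff_subset.trans Ioo_subset_Icc_self
  have key : HasDerivAt (fun y => (b - a) * ρ y) (D x) x :=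
    hasDerivAt_of_tendstoUniformlyOn (isOpen_Ioo.sdiff hSfin.isClosed) (hD.mono hsub)
      (Eventually.of_forall hderiv) (fun y hy => hlim y (hsub hy)) hxU
  have hba : b - a ≠ 0 := (sub_pos.2 hab).ne'
  refine hx.2 ?_
  have := (key.const_mul (b - a)⁻¹).differentiableAt
  simpa only [inv_mul_cancel_left₀ hba] using this
end

section
/- Let f be a mixing piecewise expanding unimodal map with C² branches whose critical point c is not periodic, and let ρ be the density of its unique absolutely continuous invariant probability measure; assume ρ(c) > 0. Let 0 < β < 1 satisfy β · max_x |f'(x)| < 1 (maximum over points where f is differentiable). Then ρ is not differentiable at any point x̄ of the set 𝒩_β = {x ∈ [0,1] : |c_n − x| ≤ βⁿ for infinitely many n}. -/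
open MeasureTheory Set Filter Topology Asymptotics
open scoped ENNReal NNReal

/-- The one-sided limits of `φ` at `x` exist, and the right one minus the left one is `j`. -/
def HasJump (φ : ℝ → ℝ) (x j : ℝ) : Prop :=
  ∃ r l, Tendsto φ (𝓝[>] x) (𝓝 r) ∧ Tendsto φ (𝓝[<] x) (𝓝 l) ∧ r - l = j

theorem HasJump.unique {φ : ℝ → ℝ} {x j k : ℝ} (hj : HasJump φ x j) (hk : HasJump φ x k) :
    j = k := by
  obtain ⟨r, l, hr, hl, rfl⟩ := hj
  obtain ⟨r', l', hr', hl', rfl⟩ := hk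
  rw [tendsto_nhds_unique hr hr', tendsto_nhds_unique hl hl']

theorem HasJump.add {φ ψ : ℝ → ℝ} {x j k : ℝ} (hj : HasJump φ x j) (hk : HasJump ψ x k) :
    HasJump (fun y => φ y + ψ y) x (j + k) := by
  obtain ⟨r, l, hr, hl, rfl⟩ := hj
  obtain ⟨r', l', hr', hl', rfl⟩ := hk
  exact ⟨_, _, hr.add hr', hl.add hl', by ring⟩

theorem ContinuousAt.hasJump_zero {φ : ℝ → ℝ} {x : ℝ} (h : ContinuousAt φ x) :
    HasJump φ x 0 :=
  ⟨_, _, h.tendsto.mono_left nhdsWithin_le_nhds, h.tendsto.mono_left nhdsWithin_le_nhds,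
    sub_self _⟩

theorem StrictMono.tendsto_nhdsGT {g : ℝ → ℝ} (hg : StrictMono g) (hc : Continuous g) (x : ℝ) :
    Tendsto g (𝓝[>] x) (𝓝[>] (g x)) :=
  tendsto_nhdsWithin_of_tendsto_nhds_of_eventually_within _
    (hc.continuousAt.tendsto.mono_left nhdsWithin_le_nhds)
    (eventually_nhdsWithin_of_forall fun _ hy => hg hy)

theorem StrictMono.tendsto_nhdsLT {g : ℝ → ℝ} (hg : StrictMono g) (hc : Continuous g) (x : ℝ) :
    Tendsto g (𝓝[<] x) (𝓝[<] (g x)) :=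
  tendsto_nhdsWithin_of_tendsto_nhds_of_eventually_within _
    (hc.continuousAt.tendsto.mono_left nhdsWithin_le_nhds)
    (eventually_nhdsWithin_of_forall fun _ hy => hg hy)

theorem HasJump.comp_strictMono {φ g : ℝ → ℝ} {x j : ℝ} (hg : StrictMono g) (hc : Continuous g)
    (h : HasJump φ (g x) j) : HasJump (fun y => φ (g y)) x j := by
  obtain ⟨r, l, hr, hl, rfl⟩ := h
  exact ⟨r, l, hr.comp (hg.tendsto_nhdsGT hc x), hl.comp (hg.tendsto_nhdsLT hc x), rfl⟩

theorem HasJump.comp_sign_mul {φ : ℝ → ℝ} {x j s : ℝ} (hs : s = 1 ∨ s = -1)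
    (h : HasJump φ (s * x) j) : HasJump (fun y => φ (s * y)) x (s * j) := by
  obtain ⟨r, l, hr, hl, rfl⟩ := h
  rcases hs with rfl | rfl
  · simp only [one_mul] at *
    exact ⟨r, l, hr, hl, rfl⟩
  · simp only [neg_mul, one_mul] at *
    exact ⟨l, r, hl.comp tendsto_neg_nhdsGT, hr.comp tendsto_neg_nhdsLT, by ring⟩

/-- A continuous strictly increasing function on a compact interval extends to an order
isomorphism of the line. -/
theorem exists_orderIso_eqOn_Icc {a b : ℝ} (hab : a ≤ b) {F : ℝ → ℝ}
    (hc : ContinuousOn F (Icc a b)) (hm : StrictMonoOn F (Icc a b)) :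
    ∃ e : ℝ ≃o ℝ, ∀ z ∈ Icc a b, e z = F z := by
  let p : ℝ → ℝ := fun z => projIcc a b hab z
  have hpm : ∀ z, p z ∈ Icc a b := fun z => (projIcc a b hab z).2
  have hpc : Continuous p := continuous_subtype_val.comp continuous_projIcc
  have hmono : StrictMono fun z => F (p z) + (z - p z) := by
    intro x y hxy
    have h1 : p x ≤ p y := monotone_projIcc hab hxy.le
    have h2 : |p x - p y| ≤ |x - y| := abs_projIcc_sub_projIcc hab
    rw [abs_of_nonpos (by linarith), abs_of_nonpos (by linarith)] at h2
    rcases h1.eq_or_lt with h | h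
    · simp only [h]; linarith
    · have := hm (hpm x) (hpm y) h
      simp only; linarith
  have hcont : Continuous fun z => F (p z) + (z - p z) :=
    (hc.comp_continuous hpc hpm).add (continuous_id.sub hpc)
  have hlow : ∀ z, F a ≤ F (p z) := fun z =>
    hm.monotoneOn (left_mem_Icc.2 hab) (hpm z) (hpm z).1
  have hupp : ∀ z, F (p z) ≤ F b := fun z =>
    hm.monotoneOn (hpm z) (right_mem_Icc.2 hab) (hpm z).2
  have hsurj : Function.Surjective fun z => F (p z) + (z - p z) := by
    refine hcont.surjective ?_ ?_
    · refine tendsto_atTop_mono (f := fun z => z + (F a - b)) (fun z => ?_)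
        (tendsto_atTop_add_const_right _ _ tendsto_id)
      have := hlow z; have := (hpm z).2
      linarith
    · refine tendsto_atBot_mono (f := fun z => z + (F b - a)) (fun z => ?_)
        (tendsto_atBot_add_const_right _ _ tendsto_id)
      have := hupp z; have := (hpm z).1
      linarith
  refine ⟨hmono.orderIsoOfSurjective _ hsurj, fun z hz => ?_⟩
  have : p z = z := by simp only [p, projIcc_of_mem hab hz]
  change F (p z) + (z - p z) = F z
  rw [this]; ring

theorem continuousOn_deriv_of_contDiffOn_two {g : ℝ → ℝ} {p q : ℝ} (hpq : p < q)
    (hg : ContDiffOn ℝ 2 g (Icc p q)) (hne : ∀ x ∈ Icc p q, deriv g x ≠ 0) :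
    ContinuousOn (deriv g) (Icc p q) := by
  refine (hg.continuousOn_derivWithin (uniqueDiffOn_Icc hpq) (by norm_num)).congr fun x hx => ?_
  exact ((differentiableAt_of_deriv_ne_zero (hne x hx)).derivWithin
    (uniqueDiffOn_Icc hpq x hx)).symm

theorem deriv_eq_of_eqOn_Icc {f g : ℝ → ℝ} {a b z : ℝ} (hab : a < b) (h : EqOn f g (Icc a b))
    (hz : z ∈ Icc a b) (hf : DifferentiableAt ℝ f z) (hg : DifferentiableAt ℝ g z) :
    deriv f z = deriv g z := by
  have hu := uniqueDiffOn_Icc hab z hz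
  rw [← hf.derivWithin hu, ← hg.derivWithin hu]
  exact derivWithin_congr h (h hz)

theorem exists_sign_le_mul_of_le_abs {g : ℝ → ℝ} {a b m : ℝ} (hm : 0 < m)
    (hc : ContinuousOn g (Icc a b)) (h : ∀ x ∈ Icc a b, m ≤ |g x|) :
    ∃ s : ℝ, (s = 1 ∨ s = -1) ∧ ∀ x ∈ Icc a b, m ≤ s * g x := by
  by_contra! hcon
  obtain ⟨x, hx, hgx⟩ := hcon 1 (Or.inl rfl)
  obtain ⟨y, hy, hgy⟩ := hcon (-1) (Or.inr rfl)
  have hx' := (le_abs.1 (h x hx)).resolve_left (by linarith)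
  have hy' := (le_abs.1 (h y hy)).resolve_right (by linarith)
  have h0 := ((isPreconnected_Icc.image g hc).ordConnected).out (mem_image_of_mem g hx)
    (mem_image_of_mem g hy) (show (0 : ℝ) ∈ Icc (g x) (g y) from ⟨by linarith, by linarith⟩)
  obtain ⟨t, ht, ht0⟩ := h0
  have := h t ht
  rw [ht0, abs_zero] at this
  linarith

theorem mul_sub_le_of_le_sign_mul_deriv {g : ℝ → ℝ} {a b m s x y : ℝ} (hm : 0 < m)
    (hg : ∀ x ∈ Icc a b, m ≤ s * deriv g x) (hx : x ∈ Icc a b) (hy : y ∈ Icc a b)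
    (hxy : x ≤ y) : m * (y - x) ≤ s * g y - s * g x := by
  have hd : ∀ z ∈ Icc a b, DifferentiableAt ℝ g z := fun z hz =>
    differentiableAt_of_deriv_ne_zero fun h => by have := hg z hz; rw [h] at this; linarith
  refine (convex_Icc a b).mul_sub_le_image_sub_of_le_deriv (f := fun z => s * g z)
    (fun z hz => ((hd z hz).const_mul s).continuousAt.continuousWithinAt)
    (fun z hz => ((hd z (interior_subset hz)).const_mul s).differentiableWithinAt)
    (fun z hz => ?_) x hx y hy hxy
  rw [deriv_const_mul _ (hd z (interior_subset hz))]
  exact hg z (interior_subset hz)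

theorem strictMonoOn_of_le_sign_mul_deriv {g : ℝ → ℝ} {a b m s : ℝ} (hm : 0 < m)
    (hg : ∀ x ∈ Icc a b, m ≤ s * deriv g x) : StrictMonoOn (fun z => s * g z) (Icc a b) :=
  fun x hx y hy hxy => by
    have := mul_sub_le_of_le_sign_mul_deriv hm hg hx hy hxy.le
    have := mul_pos hm (sub_pos.2 hxy)
    simp only; linarith

namespace PEUM

theorem continuousOn_deriv_f₁ (P : PEUM) : ContinuousOn (deriv P.f₁) (Icc 0 P.c) :=
  (continuousOn_deriv_of_contDiffOn_two (by linarith [P.c_mem.1, P.eps_pos]) P.smooth₁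
    fun x hx h => by
      have := P.expand₁ x hx
      rw [h, abs_zero] at this
      linarith [P.lam_gt_one]).mono (Icc_subset_Icc le_rfl (by linarith [P.eps_pos]))

theorem continuousOn_deriv_f₂ (P : PEUM) : ContinuousOn (deriv P.f₂) (Icc P.c 1) :=
  (continuousOn_deriv_of_contDiffOn_two (by linarith [P.c_mem.2, P.eps_pos]) P.smooth₂
    fun x hx h => by
      have := P.expand₂ x hx
      rw [h, abs_zero] at this
      linarith [P.lam_gt_one]).mono (Icc_subset_Icc (by linarith [P.eps_pos]) le_rfl)

theorem eqOn_f₁ (P : PEUM) : EqOn P.f P.f₁ (Icc 0 P.c) := fun x hx =>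
  P.eq₁ x ⟨hx.1, hx.2.trans P.c_mem.2.le⟩ hx.2

theorem eqOn_f₂ (P : PEUM) : EqOn P.f P.f₂ (Icc P.c 1) := fun x hx =>
  P.eq₂ x ⟨P.c_mem.1.le.trans hx.1, hx.2⟩ hx.1

/-- One branch is increasing and the other one decreasing. -/
theorem exists_sign (P : PEUM) : ∃ s : ℝ, (s = 1 ∨ s = -1) ∧
    (∀ x ∈ Icc 0 P.c, P.lam ≤ s * deriv P.f₁ x) ∧
    ∀ x ∈ Icc P.c 1, P.lam ≤ -s * deriv P.f₂ x := by
  have hl : 0 < P.lam := by linarith [P.lam_gt_one]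
  have hc0 := P.c_mem.1
  have hc1 := P.c_mem.2
  obtain ⟨s, hs, h1⟩ := exists_sign_le_mul_of_le_abs hl P.continuousOn_deriv_f₁ fun x hx =>
    P.expand₁ x ⟨hx.1, by linarith [hx.2, P.eps_pos]⟩
  obtain ⟨t, ht, h2⟩ := exists_sign_le_mul_of_le_abs hl P.continuousOn_deriv_f₂ fun x hx =>
    P.expand₂ x ⟨by linarith [hx.1, P.eps_pos], hx.2⟩
  have hst : t = -s := by
    by_contra hne
    have hts : t = s := by rcases hs with rfl | rfl <;> rcases ht with rfl | rfl <;> simp_all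
    subst hts
    have m1 := mul_sub_le_of_le_sign_mul_deriv hl h1 ⟨le_rfl, hc0.le⟩ ⟨hc0.le, le_rfl⟩ hc0.le
    have m2 := mul_sub_le_of_le_sign_mul_deriv hl h2 ⟨le_rfl, hc1.le⟩ ⟨hc1.le, le_rfl⟩ hc1.le
    rw [← P.branch_eq, ← P.eqOn_f₁ ⟨hc0.le, le_rfl⟩, ← P.eqOn_f₂ ⟨hc1.le, le_rfl⟩] at m2
    rw [← P.eqOn_f₁ ⟨hc0.le, le_rfl⟩, ← P.eqOn_f₁ ⟨le_rfl, hc0.le⟩] at m1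
    have b0 := P.mapsTo (show (0 : ℝ) ∈ Icc (0 : ℝ) 1 by simp)
    have b1 := P.mapsTo (show (1 : ℝ) ∈ Icc (0 : ℝ) 1 by simp)
    have := P.lam_gt_one
    rcases hs with rfl | rfl <;> nlinarith [b0.1, b0.2, b1.1, b1.2]
  exact ⟨s, hs, h1, hst ▸ h2⟩

theorem deriv_f_c (P : PEUM) : deriv P.f P.c = 0 := by
  by_contra hne
  have hf := differentiableAt_of_deriv_ne_zero hne
  obtain ⟨s, hs, h1, h2⟩ := P.exists_sign
  have hl := P.lam_gt_one
  have h1 := h1 P.c ⟨P.c_mem.1.le, le_rfl⟩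
  have h2 := h2 P.c ⟨le_rfl, P.c_mem.2.le⟩
  rw [← deriv_eq_of_eqOn_Icc P.c_mem.1 P.eqOn_f₁ ⟨P.c_mem.1.le, le_rfl⟩ hf
    (differentiableAt_of_deriv_ne_zero fun h => by rw [h] at h1; linarith)] at h1
  rw [← deriv_eq_of_eqOn_Icc P.c_mem.2 P.eqOn_f₂ ⟨le_rfl, P.c_mem.2.le⟩ hf
    (differentiableAt_of_deriv_ne_zero fun h => by rw [h] at h2; linarith)] at h2
  linarith

theorem inv_abs_deriv_f_le (P : PEUM) {z : ℝ} (hz : z ∈ Icc (0 : ℝ) 1) :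
    |deriv P.f z|⁻¹ ≤ P.lam⁻¹ := by
  have hl := P.lam_gt_one
  by_cases h0 : deriv P.f z = 0
  · rw [h0, abs_zero, inv_zero]
    exact inv_nonneg.2 (by linarith)
  have hf := differentiableAt_of_deriv_ne_zero h0
  refine inv_anti₀ (by linarith) ?_
  rcases le_total z P.c with h | h
  · have := P.expand₁ z ⟨hz.1, by linarith [P.eps_pos]⟩
    rwa [deriv_eq_of_eqOn_Icc P.c_mem.1 P.eqOn_f₁ ⟨hz.1, h⟩ hf
      (differentiableAt_of_deriv_ne_zero fun h' => by rw [h', abs_zero] at this; linarith)]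
  · have := P.expand₂ z ⟨by linarith [P.eps_pos], hz.2⟩
    rwa [deriv_eq_of_eqOn_Icc P.c_mem.2 P.eqOn_f₂ ⟨h, hz.2⟩ hf
      (differentiableAt_of_deriv_ne_zero fun h' => by rw [h', abs_zero] at this; linarith)]

/-- Data attached to the branch of `P.f` on `[a, b]`: an order isomorphism `e` extending
`s * P.f`, and a continuous extension `w` of `1 / |P.f'|`, bounded below by `M⁻¹`. -/
structure IsBranch (P : PEUM) (M a b s : ℝ) (e : ℝ ≃o ℝ) (w : ℝ → ℝ) : Prop where
  lt : a < b
  apply_eq : ∀ z ∈ Icc a b, e z = s * P.f z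
  continuous : Continuous w
  inv_abs_deriv : ∀ z ∈ Ioo a b, |deriv P.f z|⁻¹ = w z
  inv_le : ∀ z, M⁻¹ ≤ w z
  le_one : ∀ z, w z ≤ 1

theorem exists_isBranch (P : PEUM) {M a b s : ℝ} (hab : a < b) (hsub : Icc a b ⊆ Icc 0 1)
    (hs : s = 1 ∨ s = -1) {g : ℝ → ℝ} (hfg : EqOn P.f g (Icc a b))
    (hc : ContinuousOn (deriv g) (Icc a b)) (hg : ∀ x ∈ Icc a b, P.lam ≤ s * deriv g x)
    (hM : ∀ x ∈ Icc (0 : ℝ) 1, DifferentiableAt ℝ P.f x → |deriv P.f x| ≤ M) :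
    ∃ e w, P.IsBranch M a b s e w := by
  have hl := P.lam_gt_one
  have hl0 : 0 < P.lam := by linarith
  have habs : ∀ x ∈ Icc a b, P.lam ≤ |deriv g x| := fun x hx => by
    have := hg x hx
    rcases hs with rfl | rfl
    · exact le_abs.2 (Or.inl (by linarith))
    · exact le_abs.2 (Or.inr (by linarith))
  have hd : ∀ x ∈ Icc a b, DifferentiableAt ℝ g x := fun x hx =>
    differentiableAt_of_deriv_ne_zero fun h => by
      have := habs x hx
      rw [h, abs_zero] at this; linarith
  have hev : ∀ z ∈ Ioo a b, P.f =ᶠ[𝓝 z] g := fun z hz =>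
    (hfg.mono Ioo_subset_Icc_self).eventuallyEq_of_mem (Ioo_mem_nhds hz.1 hz.2)
  have hub : ∀ x ∈ Icc a b, |deriv g x| ≤ M := by
    have hcl : closure (Ioo a b) = Icc a b := closure_Ioo hab.ne
    intro x hx
    refine le_on_closure (s := Ioo a b) (f := fun x => |deriv g x|) (g := fun _ => M)
      (fun z hz => ?_) (by rw [hcl]; exact hc.abs) continuousOn_const (hcl ▸ hx)
    rw [← (hev z hz).deriv_eq]
    exact hM z (hsub (Ioo_subset_Icc_self hz))
      ((hev z hz).differentiableAt_iff.2 (hd z (Ioo_subset_Icc_self hz)))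
  obtain ⟨e, he⟩ := exists_orderIso_eqOn_Icc hab.le (F := fun z => s * g z)
    (fun z hz => ((hd z hz).const_mul s).continuousAt.continuousWithinAt)
    (strictMonoOn_of_le_sign_mul_deriv hl0 hg)
  have hp : ∀ z : ℝ, (projIcc a b hab.le z : ℝ) ∈ Icc a b := fun z => (projIcc a b hab.le z).2
  refine ⟨e, fun z => |deriv g (projIcc a b hab.le z)|⁻¹, hab, fun z hz => ?_, ?_,
    fun z hz => ?_, fun z => ?_, fun z => ?_⟩
  · rw [he z hz, hfg hz]
  · refine Continuous.inv₀ (hc.comp_continuous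
      (continuous_subtype_val.comp continuous_projIcc) hp).abs fun z => ?_
    have := habs _ (hp z)
    intro h
    rw [h] at this; linarith
  · rw [projIcc_of_mem hab.le (Ioo_subset_Icc_self hz), (hev z hz).deriv_eq]
  · exact inv_anti₀ (by linarith [habs _ (hp z)]) (hub _ (hp z))
  · exact inv_le_one_of_one_le₀ (by linarith [habs _ (hp z)])

/-- The contribution to the Perron–Frobenius operator of the preimages in `[a, b]`. -/
noncomputable def weighted (P : PEUM) (a b : ℝ) (φ : ℝ → ℝ) (z : ℝ) : ℝ :=
  open Classical in if z ∈ Icc a b then φ z * |deriv P.f z|⁻¹ else 0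

theorem weighted_of_mem (P : PEUM) {a b z : ℝ} (φ : ℝ → ℝ) (hz : z ∈ Icc a b) :
    P.weighted a b φ z = φ z * |deriv P.f z|⁻¹ := if_pos hz

theorem weighted_of_notMem (P : PEUM) {a b z : ℝ} (φ : ℝ → ℝ) (hz : z ∉ Icc a b) :
    P.weighted a b φ z = 0 := if_neg hz

theorem weighted_c (P : PEUM) (a b : ℝ) (φ : ℝ → ℝ) : P.weighted a b φ P.c = 0 := by
  by_cases h : P.c ∈ Icc a b
  · rw [P.weighted_of_mem φ h, P.deriv_f_c, abs_zero, inv_zero, mul_zero]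
  · exact P.weighted_of_notMem φ h

theorem PF_eq_tsum (P : PEUM) (φ : ℝ → ℝ) (y : ℝ) :
    P.PF φ y = ∑' z : ℝ, {z | z ∈ Icc (0 : ℝ) 1 ∧ P.f z = y}.indicator
      (fun z => φ z * |deriv P.f z|⁻¹) z := by
  rw [← tsum_subtype]
  simp only [PF, transfer, pow_zero, one_mul, div_eq_mul_inv]
  rfl

theorem PF_of_notMem (P : PEUM) (φ : ℝ → ℝ) {y : ℝ} (hy : y ∉ Icc (0 : ℝ) 1) :
    P.PF φ y = 0 := by
  rw [P.PF_eq_tsum]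
  refine (tsum_congr fun z => indicator_of_notMem ?_ _).trans tsum_zero
  rintro ⟨hz, rfl⟩
  exact hy (P.mapsTo hz)

theorem PF_congr (P : PEUM) {φ ψ : ℝ → ℝ} (h : EqOn φ ψ (Icc 0 1)) (y : ℝ) :
    P.PF φ y = P.PF ψ y := by
  rw [P.PF_eq_tsum, P.PF_eq_tsum]
  refine tsum_congr fun z => ?_
  by_cases hz : z ∈ {z | z ∈ Icc (0 : ℝ) 1 ∧ P.f z = y}
  · rw [indicator_of_mem hz, indicator_of_mem hz, h hz.1]
  · rw [indicator_of_notMem hz, indicator_of_notMem hz]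

section Branches

variable {P : PEUM} {M s : ℝ} {e₁ e₂ : ℝ ≃o ℝ} {w₁ w₂ : ℝ → ℝ}

theorem IsBranch.eq_symm_iff {a b t : ℝ} {e : ℝ ≃o ℝ} {w : ℝ → ℝ} (h : P.IsBranch M a b t e w)
    (ht : t = 1 ∨ t = -1) {z y : ℝ} (hz : z ∈ Icc a b) : z = e.symm (t * y) ↔ P.f z = y := by
  rw [OrderIso.eq_symm_apply, h.apply_eq z hz]
  have ht0 : t ≠ 0 := by rcases ht with rfl | rfl <;> norm_num
  exact mul_right_inj' ht0

theorem neg_sign (hs : s = 1 ∨ s = -1) : -s = 1 ∨ -s = -1 := by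
  rcases hs with rfl | rfl <;> simp

/-- The Perron–Frobenius operator as a sum over the two inverse branches. -/
theorem PF_eq_add (hs : s = 1 ∨ s = -1) (h₁ : P.IsBranch M 0 P.c s e₁ w₁)
    (h₂ : P.IsBranch M P.c 1 (-s) e₂ w₂) (φ : ℝ → ℝ) (y : ℝ) :
    P.PF φ y = P.weighted 0 P.c φ (e₁.symm (s * y)) +
      P.weighted P.c 1 φ (e₂.symm (-s * y)) := by
  classical
  have hc0 := P.c_mem.1
  have hc1 := P.c_mem.2
  rw [P.PF_eq_tsum]
  set z₁ := e₁.symm (s * y)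
  set z₂ := e₂.symm (-s * y)
  have key : ∀ z, {z | z ∈ Icc (0 : ℝ) 1 ∧ P.f z = y}.indicator
      (fun z => φ z * |deriv P.f z|⁻¹) z =
      (if z = z₁ then P.weighted 0 P.c φ z₁ else 0) +
        if z = z₂ then P.weighted P.c 1 φ z₂ else 0 := by
    intro z
    have r₁ : (if z = z₁ then P.weighted 0 P.c φ z₁ else 0) =
        if z = z₁ then P.weighted 0 P.c φ z else 0 := by split_ifs with h <;> simp [h]
    have r₂ : (if z = z₂ then P.weighted P.c 1 φ z₂ else 0) =
        if z = z₂ then P.weighted P.c 1 φ z else 0 := by split_ifs with h <;> simp [h]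
    rw [r₁, r₂, indicator_apply]
    rcases lt_trichotomy z P.c with h | rfl | h
    · rw [P.weighted_of_notMem (a := P.c) φ fun h' => absurd h'.1 (not_le.2 h), ite_self, add_zero]
      by_cases hz : 0 ≤ z
      · have hz' : z ∈ Icc 0 P.c := ⟨hz, h.le⟩
        rw [P.weighted_of_mem φ hz']
        refine if_congr (Iff.trans ?_ (h₁.eq_symm_iff hs hz').symm) rfl rfl
        exact ⟨fun h => h.2, fun h' => ⟨⟨hz, by linarith⟩, h'⟩⟩
      · rw [P.weighted_of_notMem φ fun h' => hz h'.1, ite_self]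
        exact if_neg fun h' => hz h'.1.1
    · rw [P.weighted_c, P.weighted_c, P.deriv_f_c]
      simp
    · rw [P.weighted_of_notMem (a := 0) φ fun h' => absurd h'.2 (not_le.2 h), ite_self, zero_add]
      by_cases hz : z ≤ 1
      · have hz' : z ∈ Icc P.c 1 := ⟨h.le, hz⟩
        rw [P.weighted_of_mem φ hz']
        refine if_congr (Iff.trans ?_ (h₂.eq_symm_iff (neg_sign hs) hz').symm) rfl rfl
        exact ⟨fun h => h.2, fun h' => ⟨⟨by linarith, hz⟩, h'⟩⟩
      · rw [P.weighted_of_notMem φ fun h' => hz h'.2, ite_self]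
        exact if_neg fun h' => hz h'.1.2
  rw [tsum_congr key, Summable.tsum_add, tsum_ite_eq, tsum_ite_eq]
  · exact (hasSum_ite_eq z₁ _).summable
  · exact (hasSum_ite_eq z₂ _).summable

theorem IsBranch.hasJump_weighted {a b t : ℝ} {e : ℝ ≃o ℝ} {w : ℝ → ℝ}
    (h : P.IsBranch M a b t e w) {φ : ℝ → ℝ} {z r l : ℝ} (hr : Tendsto φ (𝓝[>] z) (𝓝 r))
    (hl : Tendsto φ (𝓝[<] z) (𝓝 l)) :
    HasJump (P.weighted a b φ) z
      ((Ico a b).indicator (fun x => r * w x) z - (Ioc a b).indicator (fun x => l * w x) z) := by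
  have hin : ∀ x ∈ Ioo a b, P.weighted a b φ x = φ x * w x := fun x hx => by
    rw [P.weighted_of_mem φ (Ioo_subset_Icc_self hx), h.inv_abs_deriv x hx]
  have hw : Tendsto w (𝓝 z) (𝓝 (w z)) := h.continuous.tendsto z
  refine ⟨_, _, ?_, ?_, rfl⟩
  · by_cases hz : z ∈ Ico a b
    · rw [indicator_of_mem hz]
      refine (hr.mul (hw.mono_left nhdsWithin_le_nhds)).congr' ?_
      filter_upwards [Ioo_mem_nhdsGT_of_mem hz] with x hx using (hin x hx).symm
    · rw [indicator_of_notMem hz]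
      refine tendsto_const_nhds.congr' ?_
      rcases lt_or_ge z a with h' | h'
      · filter_upwards [nhdsWithin_le_nhds (Iio_mem_nhds h')] with x hx
        exact (P.weighted_of_notMem φ fun h'' => absurd h''.1 (not_le.2 hx)).symm
      · have hb : b ≤ z := not_lt.1 fun h'' => hz ⟨h', h''⟩
        filter_upwards [self_mem_nhdsWithin] with x hx
        exact (P.weighted_of_notMem φ fun h'' =>
          absurd h''.2 (not_le.2 (hb.trans_lt hx))).symm
  · by_cases hz : z ∈ Ioc a b
    · rw [indicator_of_mem hz]
      refine (hl.mul (hw.mono_left nhdsWithin_le_nhds)).congr' ?_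
      filter_upwards [Ioo_mem_nhdsLT_of_mem hz] with x hx using (hin x hx).symm
    · rw [indicator_of_notMem hz]
      refine tendsto_const_nhds.congr' ?_
      rcases lt_or_ge b z with h' | h'
      · filter_upwards [nhdsWithin_le_nhds (Ioi_mem_nhds h')] with x hx
        exact (P.weighted_of_notMem φ fun h'' => absurd h''.2 (not_le.2 hx)).symm
      · have ha : z ≤ a := not_lt.1 fun h'' => hz ⟨h'', h'⟩
        filter_upwards [self_mem_nhdsWithin] with x hx
        exact (P.weighted_of_notMem φ fun h'' =>
          absurd h''.1 (not_le.2 (lt_of_lt_of_le hx ha))).symm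

theorem IsBranch.continuousAt_weighted {a b t : ℝ} {e : ℝ ≃o ℝ} {w : ℝ → ℝ}
    (h : P.IsBranch M a b t e w) (hsub : Icc a b ⊆ Icc 0 1) {φ : ℝ → ℝ} {z : ℝ}
    (hφ : z ∈ Icc a b → ContinuousAt φ z) (hz : z ∉ Ioo a b → z ∈ Icc a b → φ z = 0) :
    ContinuousAt (P.weighted a b φ) z := by
  by_cases hz1 : z ∈ Icc a b
  · by_cases hz2 : z ∈ Ioo a b
    · refine ((hφ hz1).mul h.continuous.continuousAt).congr ?_
      filter_upwards [Ioo_mem_nhds hz2.1 hz2.2] with x hx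
      rw [P.weighted_of_mem φ (Ioo_subset_Icc_self hx), h.inv_abs_deriv x hx, Pi.mul_apply]
    · have h0 := hz hz2 hz1
      have hle : ∀ x, ‖P.weighted a b φ x‖ ≤ |φ x| := fun x => by
        by_cases hx : x ∈ Icc a b
        · have h1 := P.inv_abs_deriv_f_le (hsub hx)
          have h2 : P.lam⁻¹ ≤ 1 := inv_le_one_of_one_le₀ P.lam_gt_one.le
          rw [P.weighted_of_mem φ hx, Real.norm_eq_abs, abs_mul,
            abs_of_nonneg (a := |_|⁻¹) (by positivity)]
          exact mul_le_of_le_one_right (abs_nonneg _) (h1.trans h2)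
        · rw [P.weighted_of_notMem φ hx, norm_zero]
          exact abs_nonneg _
      have ht : Tendsto (fun x => |φ x|) (𝓝 z) (𝓝 0) := by
        simpa [h0] using (hφ hz1).abs.tendsto
      have hv : P.weighted a b φ z = 0 := by rw [P.weighted_of_mem φ hz1, h0, zero_mul]
      rw [ContinuousAt, hv]
      exact squeeze_zero_norm hle ht
  · refine (continuousAt_const (y := (0 : ℝ))).congr ?_
    filter_upwards [isClosed_Icc.isOpen_compl.mem_nhds hz1] with x hx
    exact (P.weighted_of_notMem φ hx).symm

theorem apply_ne_c (hs : s = 1 ∨ s = -1) (h₁ : P.IsBranch M 0 P.c s e₁ w₁)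
    (h₂ : P.IsBranch M P.c 1 (-s) e₂ w₂) {z : ℝ} (hz : z ∈ Icc (0 : ℝ) 1) (hzc : z ≠ P.c) :
    P.f z ≠ P.f P.c := by
  intro h
  rcases le_total z P.c with h' | h'
  · have a := (h₁.eq_symm_iff hs ⟨hz.1, h'⟩).2 h
    have b := (h₁.eq_symm_iff hs ⟨P.c_mem.1.le, le_rfl⟩).2 rfl
    exact hzc (a.trans b.symm)
  · have a := (h₂.eq_symm_iff (neg_sign hs) ⟨h', hz.2⟩).2 h
    have b := (h₂.eq_symm_iff (neg_sign hs) ⟨le_rfl, P.c_mem.2.le⟩).2 rfl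
    exact hzc (a.trans b.symm)

theorem eq_zero_of_continuousAt {φ : ℝ → ℝ} (h0 : ∀ x, x ∉ Icc (0 : ℝ) 1 → φ x = 0) {z : ℝ}
    (hz : z ∉ Ioo (0 : ℝ) 1) (hc : ContinuousAt φ z) : φ z = 0 := by
  by_cases hz' : z ∈ Icc (0 : ℝ) 1
  · rcases hz'.1.eq_or_lt with rfl | hlt
    · refine tendsto_nhds_unique (hc.tendsto.mono_left (nhdsWithin_le_nhds (s := Iio 0)))
        (tendsto_const_nhds.congr' ?_)
      filter_upwards [self_mem_nhdsWithin] with x hx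
      exact (h0 x fun h => absurd h.1 (not_le.2 hx)).symm
    · obtain rfl : z = 1 := le_antisymm hz'.2 (not_lt.1 fun h => hz ⟨hlt, h⟩)
      refine tendsto_nhds_unique (hc.tendsto.mono_left (nhdsWithin_le_nhds (s := Ioi 1)))
        (tendsto_const_nhds.congr' ?_)
      filter_upwards [self_mem_nhdsWithin] with x hx
      exact (h0 x fun h => absurd h.2 (not_le.2 hx)).symm
  · exact h0 z hz'

/-- The Perron–Frobenius operator preserves continuity at points other than `P.f P.c` whose
preimages are all points of continuity. -/
theorem continuousAt_PF (hs : s = 1 ∨ s = -1) (h₁ : P.IsBranch M 0 P.c s e₁ w₁)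
    (h₂ : P.IsBranch M P.c 1 (-s) e₂ w₂) {φ : ℝ → ℝ} (h0 : ∀ x, x ∉ Icc (0 : ℝ) 1 → φ x = 0)
    {y : ℝ} (hy : y ≠ P.f P.c) (hφ : ∀ z ∈ Icc (0 : ℝ) 1, P.f z = y → ContinuousAt φ z) :
    ContinuousAt (P.PF φ) y := by
  have hc0 := P.c_mem.1
  have hc1 := P.c_mem.2
  have s₁ : Icc 0 P.c ⊆ Icc (0 : ℝ) 1 := Icc_subset_Icc le_rfl hc1.le
  have s₂ : Icc P.c 1 ⊆ Icc (0 : ℝ) 1 := Icc_subset_Icc hc0.le le_rfl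
  have hfun : P.PF φ = fun y => P.weighted 0 P.c φ (e₁.symm (s * y)) +
      P.weighted P.c 1 φ (e₂.symm (-s * y)) := funext (PF_eq_add hs h₁ h₂ φ)
  rw [hfun]
  refine ContinuousAt.add ?_ ?_
  · have hcont : ∀ z ∈ Icc 0 P.c, z = e₁.symm (s * y) → z ≠ P.c ∧ ContinuousAt φ z :=
      fun z hz hze => by
        have := (h₁.eq_symm_iff hs hz).1 hze
        exact ⟨fun h => hy (by rw [← this, h]), hφ z (s₁ hz) this⟩
    refine ContinuousAt.comp (g := P.weighted 0 P.c φ) (f := fun y => e₁.symm (s * y)) ?_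
      (e₁.symm.continuous.comp (continuous_const.mul continuous_id)).continuousAt
    refine h₁.continuousAt_weighted s₁ (fun hz => (hcont _ hz rfl).2) fun hn hz => ?_
    refine eq_zero_of_continuousAt h0 (fun h => hn ⟨h.1, ?_⟩) (hcont _ hz rfl).2
    exact lt_of_le_of_ne hz.2 (hcont _ hz rfl).1
  · have hcont : ∀ z ∈ Icc P.c 1, z = e₂.symm (-s * y) → z ≠ P.c ∧ ContinuousAt φ z :=
      fun z hz hze => by
        have := (h₂.eq_symm_iff (neg_sign hs) hz).1 hze
        exact ⟨fun h => hy (by rw [← this, h]), hφ z (s₂ hz) this⟩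
    refine ContinuousAt.comp (g := P.weighted P.c 1 φ) (f := fun y => e₂.symm (-s * y)) ?_
      (e₂.symm.continuous.comp (continuous_const.mul continuous_id)).continuousAt
    refine h₂.continuousAt_weighted s₂ (fun hz => (hcont _ hz rfl).2) fun hn hz => ?_
    refine eq_zero_of_continuousAt h0 (fun h => hn ⟨?_, h.2⟩) (hcont _ hz rfl).2
    exact lt_of_le_of_ne hz.1 (hcont _ hz rfl).1.symm

end Branches

end PEUM

/-- The jump of `φ` at `x`. -/
noncomputable def jump (φ : ℝ → ℝ) (x : ℝ) : ℝ := Function.rightLim φ x - Function.leftLim φ x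

namespace BoundedVariationOn

theorem hasJump_jump {φ : ℝ → ℝ} (h : BoundedVariationOn φ univ) (x : ℝ) :
    HasJump φ x (jump φ x) :=
  ⟨_, _, h.tendsto_rightLim x, h.tendsto_leftLim x, rfl⟩

theorem jump_eq {φ : ℝ → ℝ} (h : BoundedVariationOn φ univ) {x j : ℝ} (hj : HasJump φ x j) :
    jump φ x = j :=
  (h.hasJump_jump x).unique hj

end BoundedVariationOn

namespace PEUM

section Branches

variable {P : PEUM} {M s : ℝ} {e₁ e₂ : ℝ ≃o ℝ} {w₁ w₂ : ℝ → ℝ} {φ : ℝ → ℝ}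

theorem jump_eq_of_PF_eq (hs : s = 1 ∨ s = -1) (h₁ : P.IsBranch M 0 P.c s e₁ w₁)
    (h₂ : P.IsBranch M P.c 1 (-s) e₂ w₂) (hbv : BoundedVariationOn φ univ)
    (hPF : ∀ y, P.PF φ y = φ y) {y j₁ j₂ : ℝ}
    (hj₁ : HasJump (P.weighted 0 P.c φ) (e₁.symm (s * y)) j₁)
    (hj₂ : HasJump (P.weighted P.c 1 φ) (e₂.symm (-s * y)) j₂) :
    jump φ y = s * (j₁ - j₂) := by
  have hfun : φ = fun y => P.weighted 0 P.c φ (e₁.symm (s * y)) +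
      P.weighted P.c 1 φ (e₂.symm (-s * y)) :=
    funext fun y => (hPF y).symm.trans (PF_eq_add hs h₁ h₂ φ y)
  have := ((hj₁.comp_strictMono e₁.symm.strictMono e₁.symm.continuous).comp_sign_mul hs).add
    ((hj₂.comp_strictMono e₂.symm.strictMono e₂.symm.continuous).comp_sign_mul (neg_sign hs))
  rw [← hfun] at this
  rw [hbv.jump_eq this]
  ring

/-- A fixed point of the Perron–Frobenius operator that is continuous and positive at the
critical point has a jump at the critical value. -/
theorem jump_critical_value_ne_zero (hs : s = 1 ∨ s = -1) (h₁ : P.IsBranch M 0 P.c s e₁ w₁)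
    (h₂ : P.IsBranch M P.c 1 (-s) e₂ w₂) (hM : 0 < M) (hbv : BoundedVariationOn φ univ)
    (hPF : ∀ y, P.PF φ y = φ y) (hc : ContinuousAt φ P.c) (hpos : 0 < φ P.c) :
    jump φ (P.f P.c) ≠ 0 := by
  have hc0 := P.c_mem.1
  have hc1 := P.c_mem.2
  have e1 : P.c = e₁.symm (s * P.f P.c) := (h₁.eq_symm_iff hs ⟨hc0.le, le_rfl⟩).2 rfl
  have e2 : P.c = e₂.symm (-s * P.f P.c) :=
    (h₂.eq_symm_iff (neg_sign hs) ⟨le_rfl, hc1.le⟩).2 rfl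
  have hr := hc.tendsto.mono_left (nhdsWithin_le_nhds (s := Ioi P.c))
  have hl := hc.tendsto.mono_left (nhdsWithin_le_nhds (s := Iio P.c))
  have k₁ := h₁.hasJump_weighted hr hl
  have k₂ := h₂.hasJump_weighted hr hl
  rw [indicator_of_notMem (by simp), indicator_of_mem (right_mem_Ioc.2 hc0)] at k₁
  rw [indicator_of_mem (left_mem_Ico.2 hc1), indicator_of_notMem (by simp)] at k₂
  rw [jump_eq_of_PF_eq hs h₁ h₂ hbv hPF (by rwa [← e1]) (by rwa [← e2])]
  have a₁ := lt_of_lt_of_le (inv_pos.2 hM) (h₁.inv_le P.c)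
  have a₂ := lt_of_lt_of_le (inv_pos.2 hM) (h₂.inv_le P.c)
  have b₁ := mul_pos hpos a₁
  have b₂ := mul_pos hpos a₂
  refine mul_ne_zero (by rcases hs with rfl | rfl <;> norm_num) (ne_of_lt (by linarith))

theorem hasJump_weighted_left (h₁ : P.IsBranch M 0 P.c s e₁ w₁)
    (hbv : BoundedVariationOn φ univ) (h0 : ∀ x, x ∉ Icc (0 : ℝ) 1 → φ x = 0) {z : ℝ}
    (hz : z ≠ P.c) :
    HasJump (P.weighted 0 P.c φ) z ((Icc 0 P.c).indicator (fun x => jump φ x * w₁ x) z) := by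
  have k := h₁.hasJump_weighted (hbv.tendsto_rightLim z) (hbv.tendsto_leftLim z)
  convert k using 1
  by_cases hm : z ∈ Icc 0 P.c
  · have hlt := lt_of_le_of_ne hm.2 hz
    rw [indicator_of_mem hm, indicator_of_mem (show z ∈ Ico 0 P.c from ⟨hm.1, hlt⟩)]
    rcases hm.1.eq_or_lt with rfl | hp
    · have hl0 : Function.leftLim φ 0 = 0 := tendsto_nhds_unique (hbv.tendsto_leftLim 0)
        (tendsto_const_nhds.congr' (by
          filter_upwards [self_mem_nhdsWithin] with x hx
          exact (h0 x fun h => absurd h.1 (not_le.2 hx)).symm))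
      rw [indicator_of_notMem (by simp), jump, hl0]; ring
    · rw [indicator_of_mem (show z ∈ Ioc 0 P.c from ⟨hp, hm.2⟩), jump]; ring
  · rw [indicator_of_notMem hm, indicator_of_notMem fun h => hm (Ico_subset_Icc_self h),
      indicator_of_notMem fun h => hm (Ioc_subset_Icc_self h), sub_zero]

theorem hasJump_weighted_right (h₂ : P.IsBranch M P.c 1 s e₂ w₂)
    (hbv : BoundedVariationOn φ univ) (h0 : ∀ x, x ∉ Icc (0 : ℝ) 1 → φ x = 0) {z : ℝ}
    (hz : z ≠ P.c) :
    HasJump (P.weighted P.c 1 φ) z ((Icc P.c 1).indicator (fun x => jump φ x * w₂ x) z) := by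
  have k := h₂.hasJump_weighted (hbv.tendsto_rightLim z) (hbv.tendsto_leftLim z)
  convert k using 1
  by_cases hm : z ∈ Icc P.c 1
  · have hlt := lt_of_le_of_ne hm.1 hz.symm
    rw [indicator_of_mem hm, indicator_of_mem (s := Ioc P.c 1) ⟨hlt, hm.2⟩]
    rcases hm.2.eq_or_lt with rfl | hp
    · have hr0 : Function.rightLim φ 1 = 0 := tendsto_nhds_unique (hbv.tendsto_rightLim 1)
        (tendsto_const_nhds.congr' (by
          filter_upwards [self_mem_nhdsWithin] with x hx
          exact (h0 x fun h => absurd h.2 (not_le.2 hx)).symm))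
      rw [indicator_of_notMem (by simp), jump, hr0]; ring
    · rw [indicator_of_mem (s := Ico P.c 1) ⟨hm.1, hp⟩, jump]; ring
  · rw [indicator_of_notMem hm, indicator_of_notMem fun h => hm (Ico_subset_Icc_self h),
      indicator_of_notMem fun h => hm (Ioc_subset_Icc_self h), sub_zero]

/-- If `z` is the only preimage of `P.f z` at which `φ` jumps, then the jump at `z` is transported
to `P.f z`, divided by the derivative. -/
theorem exists_abs_jump_apply_eq (hs : s = 1 ∨ s = -1) (h₁ : P.IsBranch M 0 P.c s e₁ w₁)
    (h₂ : P.IsBranch M P.c 1 (-s) e₂ w₂) (hM : 0 < M) (hbv : BoundedVariationOn φ univ)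
    (h0 : ∀ x, x ∉ Icc (0 : ℝ) 1 → φ x = 0) (hPF : ∀ y, P.PF φ y = φ y) {z : ℝ}
    (hz : z ∈ Icc (0 : ℝ) 1) (hzc : z ≠ P.c)
    (hun : ∀ z' ∈ Icc (0 : ℝ) 1, P.f z' = P.f z → z' ≠ z → jump φ z' = 0) :
    ∃ w, M⁻¹ ≤ w ∧ w ≤ 1 ∧ |jump φ (P.f z)| = |jump φ z| * w := by
  have hc0 := P.c_mem.1
  have hc1 := P.c_mem.2
  have hMi := inv_pos.2 hM
  have hs1 : |s| = 1 := by rcases hs with rfl | rfl <;> simp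
  have hne := apply_ne_c hs h₁ h₂ hz hzc
  have hn₁ : e₁.symm (s * P.f z) ≠ P.c := fun h => hne <|
    h ▸ ((h₁.eq_symm_iff hs ⟨hc0.le, le_rfl⟩).1 h.symm).symm
  have hn₂ : e₂.symm (-s * P.f z) ≠ P.c := fun h => hne <|
    h ▸ ((h₂.eq_symm_iff (neg_sign hs) ⟨le_rfl, hc1.le⟩).1 h.symm).symm
  rw [jump_eq_of_PF_eq hs h₁ h₂ hbv hPF (hasJump_weighted_left h₁ hbv h0 hn₁)
    (hasJump_weighted_right h₂ hbv h0 hn₂), abs_mul, hs1, one_mul]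
  rcases lt_or_gt_of_ne hzc with h | h
  · have hm : z ∈ Icc 0 P.c := ⟨hz.1, h.le⟩
    refine ⟨w₁ z, h₁.inv_le z, h₁.le_one z, ?_⟩
    rw [← (h₁.eq_symm_iff hs hm).2 rfl, indicator_of_mem hm, indicator_apply_eq_zero.2 ?_,
      sub_zero, abs_mul, abs_of_pos (hMi.trans_le (h₁.inv_le z))]
    intro hm'
    rw [hun _ ⟨hc0.le.trans hm'.1, hm'.2⟩ ((h₂.eq_symm_iff (neg_sign hs) hm').1 rfl)
      (fun h' => absurd (h' ▸ hm'.1) (not_le.2 h)), zero_mul]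
  · have hm : z ∈ Icc P.c 1 := ⟨h.le, hz.2⟩
    refine ⟨w₂ z, h₂.inv_le z, h₂.le_one z, ?_⟩
    rw [← (h₂.eq_symm_iff (neg_sign hs) hm).2 rfl, indicator_of_mem hm,
      indicator_apply_eq_zero.2 ?_, zero_sub, abs_neg, abs_mul,
      abs_of_pos (hMi.trans_le (h₂.inv_le z))]
    intro hm'
    rw [hun _ ⟨hm'.1, hm'.2.trans hc1.le⟩ ((h₁.eq_symm_iff hs hm').1 rfl)
      (fun h' => absurd (h' ▸ hm'.2) (not_le.2 h)), zero_mul]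

/-- A nonnegative fixed point of the Perron–Frobenius operator on `[0, 1]` vanishes at the
endpoints. -/
theorem eq_zero_of_PF_eq (hs : s = 1 ∨ s = -1) (h₁ : P.IsBranch M 0 P.c s e₁ w₁)
    (h₂ : P.IsBranch M P.c 1 (-s) e₂ w₂) (hnn : ∀ x, 0 ≤ φ x)
    (hPF : ∀ y ∈ Icc (0 : ℝ) 1, P.PF φ y = φ y) : φ 0 = 0 ∧ φ 1 = 0 := by
  classical
  have hc0 := P.c_mem.1
  have hc1 := P.c_mem.2
  have hl := P.lam_gt_one
  have hli : 0 < P.lam⁻¹ := inv_pos.2 (by linarith)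
  have b0 := P.mapsTo (show (0 : ℝ) ∈ Icc (0 : ℝ) 1 by simp)
  have b1 := P.mapsTo (show (1 : ℝ) ∈ Icc (0 : ℝ) 1 by simp)
  have bc := P.mapsTo (show P.c ∈ Icc (0 : ℝ) 1 from ⟨hc0.le, hc1.le⟩)
  have hint : ∀ {a b t z : ℝ} {e : ℝ ≃o ℝ} {w : ℝ → ℝ}, P.IsBranch M a b t e w →
      (t = 1 ∨ t = -1) → P.f a ∈ Icc (0 : ℝ) 1 → P.f b ∈ Icc (0 : ℝ) 1 → z ∈ Ioo a b →
      P.f z ≠ 0 ∧ P.f z ≠ 1 := by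
    intro a b t z e w h ht ha hb hz
    have l1 := e.strictMono hz.1
    have l2 := e.strictMono hz.2
    rw [h.apply_eq a ⟨le_rfl, h.lt.le⟩, h.apply_eq z (Ioo_subset_Icc_self hz)] at l1
    rw [h.apply_eq b ⟨h.lt.le, le_rfl⟩, h.apply_eq z (Ioo_subset_Icc_self hz)] at l2
    constructor <;> intro h' <;> rcases ht with rfl | rfl <;>
      linarith [ha.1, ha.2, hb.1, hb.2]
  have k₁ : ∀ y, (y = 0 ∨ y = 1) → P.weighted 0 P.c φ (e₁.symm (s * y)) ≤
      if P.f 0 = y then φ 0 * P.lam⁻¹ else 0 := by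
    intro y hy
    by_cases hm : e₁.symm (s * y) ∈ Icc 0 P.c
    · have hfz := (h₁.eq_symm_iff hs hm).1 rfl
      rcases hm.1.eq_or_lt with h | h
      · rw [← h] at hfz ⊢
        rw [if_pos hfz, P.weighted_of_mem φ ⟨le_rfl, hc0.le⟩]
        exact mul_le_mul_of_nonneg_left (P.inv_abs_deriv_f_le (by simp)) (hnn 0)
      rcases hm.2.eq_or_lt with h' | h'
      · rw [h', P.weighted_c]
        split_ifs <;> [exact mul_nonneg (hnn 0) hli.le; exact le_rfl]
      · have := hint h₁ hs b0 bc ⟨h, h'⟩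
        rw [hfz] at this
        exact absurd hy (by tauto)
    · rw [P.weighted_of_notMem φ hm]
      split_ifs <;> [exact mul_nonneg (hnn 0) hli.le; exact le_rfl]
  have k₂ : ∀ y, (y = 0 ∨ y = 1) → P.weighted P.c 1 φ (e₂.symm (-s * y)) ≤
      if P.f 1 = y then φ 1 * P.lam⁻¹ else 0 := by
    intro y hy
    by_cases hm : e₂.symm (-s * y) ∈ Icc P.c 1
    · have hfz := (h₂.eq_symm_iff (neg_sign hs) hm).1 rfl
      rcases hm.2.eq_or_lt with h | h
      · rw [h] at hfz ⊢
        rw [if_pos hfz, P.weighted_of_mem φ ⟨hc1.le, le_rfl⟩]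
        exact mul_le_mul_of_nonneg_left (P.inv_abs_deriv_f_le (by simp)) (hnn 1)
      rcases hm.1.eq_or_lt with h' | h'
      · rw [← h', P.weighted_c]
        split_ifs <;> [exact mul_nonneg (hnn 1) hli.le; exact le_rfl]
      · have := hint h₂ (neg_sign hs) bc b1 ⟨h', h⟩
        rw [hfz] at this
        exact absurd hy (by tauto)
    · rw [P.weighted_of_notMem φ hm]
      split_ifs <;> [exact mul_nonneg (hnn 1) hli.le; exact le_rfl]
  have e0 := hPF 0 (by simp)
  have e1 := hPF 1 (by simp)
  rw [PF_eq_add hs h₁ h₂] at e0 e1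
  have i0 := k₁ 0 (Or.inl rfl)
  have i1 := k₁ 1 (Or.inr rfl)
  have j0 := k₂ 0 (Or.inl rfl)
  have j1 := k₂ 1 (Or.inr rfl)
  have hite : ∀ x v : ℝ, 0 ≤ v → (if x = 0 then v else 0) + (if x = 1 then v else 0) ≤ v := by
    intro x v hv
    split_ifs with h h' <;> [(rw [h] at h'; norm_num at h'); simp; simp; simpa]
  have n0 := hnn 0
  have n1 := hnn 1
  have q0 := hite (P.f 0) _ (mul_nonneg n0 hli.le)
  have q1 := hite (P.f 1) _ (mul_nonneg n1 hli.le)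
  have hli1 : P.lam⁻¹ < 1 := inv_lt_one_of_one_lt₀ hl
  have hsum : φ 0 + φ 1 ≤ (φ 0 + φ 1) * P.lam⁻¹ := by linarith
  have : φ 0 + φ 1 ≤ 0 := by nlinarith
  exact ⟨by linarith, by linarith⟩

end Branches

end PEUM

section Orbit

variable {f J : ℝ → ℝ} {x : ℕ → ℝ} {M : ℝ}

theorem apply_add_eq_of_apply_eq (hx : ∀ n, x (n + 1) = f (x n)) {a b : ℕ} (h : x a = x b)
    (i : ℕ) : x (a + i) = x (b + i) := by
  induction i with
  | zero => exact h
  | succ i ih => rw [← add_assoc, ← add_assoc, hx, hx, ih]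

/-- Along an orbit without repetitions, the weights `J` decrease at most geometrically. -/
theorem abs_le_pow_mul_of_injective (hM : 0 ≤ M) (hinj : Function.Injective x)
    (hstep : ∀ n, (∀ k, x (k + 1) = x (n + 1) → x k ≠ x n → J (x k) = 0) →
      |J (x n)| ≤ M * |J (x (n + 1))| ∧ |J (x (n + 1))| ≤ |J (x n)|) (n : ℕ) :
    |J (x 0)| ≤ M ^ n * |J (x n)| := by
  induction n with
  | zero => simp
  | succ n ih =>
    have := (hstep n fun k hk hne => absurd (congrArg x (Nat.succ_injective (hinj hk))) hne).1
    calc |J (x 0)| ≤ M ^ n * |J (x n)| := ih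
      _ ≤ M ^ n * (M * |J (x (n + 1))|) := by gcongr
      _ = M ^ (n + 1) * |J (x (n + 1))| := by ring

/-- Along a preperiodic, nonperiodic orbit, the weights `J` do not vanish on the limit cycle. -/
theorem exists_finite_image_Ici_of_not_injective (hx : ∀ n, x (n + 1) = f (x n))
    (hinj : ¬ Function.Injective x) (hx0 : ∀ k, x (k + 1) ≠ x 0) (hJ0 : J (x 0) ≠ 0)
    (hstep : ∀ n, (∀ k, x (k + 1) = x (n + 1) → x k ≠ x n → J (x k) = 0) →
      |J (x n)| ≤ M * |J (x (n + 1))| ∧ |J (x (n + 1))| ≤ |J (x n)|) :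
    ∃ p, (x '' Ici p).Finite ∧ ∀ n, p ≤ n → J (x n) ≠ 0 := by
  classical
  have hsh := fun {a b : ℕ} (h : x a = x b) i => apply_add_eq_of_apply_eq hx h i
  have hnz : ∀ n, |J (x n)| ≤ M * |J (x (n + 1))| → J (x n) ≠ 0 → J (x (n + 1)) ≠ 0 :=
    fun n h hn h' => hn (abs_nonpos_iff.1 (by simpa [h'] using h))
  have hex : ∃ n, ∃ q, 0 < q ∧ x (n + q) = x n := by
    simp only [Function.Injective] at hinj
    push Not at hinj
    obtain ⟨a, b, hab, hne⟩ := hinj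
    rcases lt_or_gt_of_ne hne with h | h
    · exact ⟨a, b - a, by omega, by rw [show a + (b - a) = b by omega, hab]⟩
    · exact ⟨b, a - b, by omega, by rw [show b + (a - b) = a by omega, hab]⟩
  obtain ⟨p, hp, hpmin⟩ : ∃ p, (∃ q, 0 < q ∧ x (p + q) = x p) ∧
      ∀ m < p, ¬ ∃ q, 0 < q ∧ x (m + q) = x m :=
    ⟨Nat.find hex, Nat.find_spec hex, fun m hm => Nat.find_min hex hm⟩
  obtain ⟨q, ⟨hq0, hq⟩, hqmin⟩ : ∃ q, (0 < q ∧ x (p + q) = x p) ∧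
      ∀ m < q, ¬ (0 < m ∧ x (p + m) = x p) :=
    ⟨Nat.find hp, Nat.find_spec hp, fun m hm => Nat.find_min hp hm⟩
  obtain ⟨r, rfl⟩ : ∃ r, p = r + 1 := by
    refine Nat.exists_eq_succ_of_ne_zero fun h => ?_
    subst h
    obtain ⟨q', rfl⟩ := Nat.exists_eq_succ_of_ne_zero hq0.ne'
    rw [Nat.zero_add] at hq
    exact hx0 q' hq
  have hper : ∀ n, r + 1 ≤ n → x (n + q) = x n := fun n hn => by
    have := hsh hq (n - (r + 1))
    rwa [show r + 1 + q + (n - (r + 1)) = n + q by omega,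
      show r + 1 + (n - (r + 1)) = n by omega] at this
  have hpre : ∀ n ≤ r, J (x n) ≠ 0 := by
    intro n hn
    induction n with
    | zero => exact hJ0
    | succ n ih =>
      refine hnz n (hstep n fun k hk hne => ?_).1 (ih (by omega))
      rcases lt_trichotomy k n with h | rfl | h
      · exact absurd ⟨n - k, by omega, by rw [show k + 1 + (n - k) = n + 1 by omega, hk]⟩
          (hpmin (k + 1) (by omega))
      · exact absurd rfl hne
      · exact absurd ⟨k - n, by omega, by rw [show n + 1 + (k - n) = k + 1 by omega, hk]⟩
          (hpmin (n + 1) (by omega))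
  have hearly : ∀ k m, k < r → r + 1 ≤ m → x (k + 1) ≠ x m := fun k m hk hm h =>
    hpmin (k + 1) (by omega) ⟨q, hq0, by rw [hsh h q, hper m hm, h]⟩
  have hback : ∀ k m, r + 1 ≤ k → x (k + 1) = x (m + 1) → x k = x (m + q) :=
    fun k m hk h => by
      have := hsh h (q - 1)
      rwa [show k + 1 + (q - 1) = k + q by omega, show m + 1 + (q - 1) = m + q by omega,
        hper k hk] at this
  have hcyc : ∀ i, i + 1 < q → |J (x (r + 1 + i))| ≤ M * |J (x (r + 1 + i + 1))| ∧
      |J (x (r + 1 + i + 1))| ≤ |J (x (r + 1 + i))| := by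
    intro i hi
    refine hstep _ fun k hk hne => ?_
    rcases lt_trichotomy k r with h | rfl | h
    · exact absurd hk (hearly k _ h (by omega))
    · exact absurd ⟨by omega, hk.symm⟩ (hqmin (i + 1) hi)
    · exact absurd ((hback k _ h hk).trans (hper _ (by omega))) hne
  have hp0 : J (x (r + 1)) ≠ 0 := by
    intro h0
    have hz : ∀ i < q, J (x (r + 1 + i)) = 0 := by
      intro i hi
      induction i with
      | zero => exact h0
      | succ i ih =>
        have := (hcyc i hi).2
        rw [ih (by omega), abs_zero] at this
        exact abs_nonpos_iff.1 this
    refine hnz r (hstep r fun k hk hne => ?_).1 (hpre r le_rfl) h0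
    rcases lt_trichotomy k r with h | rfl | h
    · exact absurd hk (hearly k _ h le_rfl)
    · exact absurd rfl hne
    · rw [hback k r h hk, show r + q = r + 1 + (q - 1) by omega]
      exact hz _ (by omega)
  have hnear : ∀ i < q, J (x (r + 1 + i)) ≠ 0 := by
    intro i hi
    induction i with
    | zero => exact hp0
    | succ i ih => exact hnz _ (hcyc i hi).1 (ih (by omega))
  have hred : ∀ m, ∃ i < q, x (r + 1 + m) = x (r + 1 + i) := by
    intro m
    induction m using Nat.strong_induction_on with
    | _ m ih =>
      rcases lt_or_ge m q with h | h
      · exact ⟨m, h, rfl⟩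
      · obtain ⟨i, hi, hxi⟩ := ih (m - q) (by omega)
        refine ⟨i, hi, ?_⟩
        rw [← hxi, ← hper (r + 1 + (m - q)) (by omega)]
        congr 1; omega
  refine ⟨r + 1, ((finite_Iio q).image fun i => x (r + 1 + i)).subset ?_, fun n hn => ?_⟩
  · rintro _ ⟨n, hn, rfl⟩
    obtain ⟨i, hi, hxi⟩ := hred (n - (r + 1))
    have hn' : r + 1 ≤ n := hn
    rw [show r + 1 + (n - (r + 1)) = n by omega] at hxi
    exact ⟨i, hi, hxi.symm⟩
  · obtain ⟨i, hi, hxi⟩ := hred (n - (r + 1))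
    rw [show r + 1 + (n - (r + 1)) = n by omega] at hxi
    rw [hxi]
    exact hnear i hi

end Orbit

theorem abs_jump_le_of_abs_sub_le {φ : ℝ → ℝ} (hbv : BoundedVariationOn φ univ) {a y L δ : ℝ}
    (h : ∀ x, |x - a| < δ → |φ x - φ a| ≤ L * |x - a|) (hy : |y - a| < δ) :
    |jump φ y| ≤ 2 * (L * |y - a|) := by
  have hnear : ∀ᶠ x in 𝓝 y, |φ x - φ a| ≤ L * |x - a| := by
    have : ContinuousAt (fun x => |x - a|) y := by fun_prop
    filter_upwards [this.eventually_lt_const hy] with x hx using h x hx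
  have hlim : Tendsto (fun x => L * |x - a|) (𝓝 y) (𝓝 (L * |y - a|)) := by
    have : ContinuousAt (fun x => L * |x - a|) y := by fun_prop
    exact this
  have hr : |Function.rightLim φ y - φ a| ≤ L * |y - a| :=
    le_of_tendsto_of_tendsto ((hbv.tendsto_rightLim y).sub_const _).abs
      (hlim.mono_left nhdsWithin_le_nhds) (hnear.filter_mono nhdsWithin_le_nhds)
  have hl : |Function.leftLim φ y - φ a| ≤ L * |y - a| :=
    le_of_tendsto_of_tendsto ((hbv.tendsto_leftLim y).sub_const _).abs
      (hlim.mono_left nhdsWithin_le_nhds) (hnear.filter_mono nhdsWithin_le_nhds)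
  rw [abs_le] at *
  unfold jump
  constructor <;> linarith

/-- A sequence approaching a point of Lipschitz continuity at a rate `βⁿ` cannot carry jumps that
decay at most like `M⁻ⁿ`, if `β * M < 1`. -/
theorem not_forall_jump_lower_bound {φ : ℝ → ℝ} (hbv : BoundedVariationOn φ univ) {x : ℕ → ℝ}
    {a L δ M β κ : ℝ} (hL : 0 ≤ L) (hδ : 0 < δ) (hM : 0 < M) (hβ0 : 0 < β) (hβ1 : β < 1)
    (hβM : β * M < 1) (hκ : 0 < κ) (h : ∀ y, |y - a| < δ → |φ y - φ a| ≤ L * |y - a|)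
    (hfreq : ∃ᶠ n in atTop, |x n - a| ≤ β ^ (n + 1)) :
    ¬ ∀ n, κ ≤ M ^ n * |jump φ (x n)| := by
  intro hlow
  have hlim₁ : Tendsto (fun n : ℕ => 2 * L * β * (β * M) ^ n) atTop (𝓝 0) := by
    simpa using (tendsto_pow_atTop_nhds_zero_of_lt_one (mul_pos hβ0 hM).le hβM).const_mul
      (2 * L * β)
  have hlim₂ : Tendsto (fun n : ℕ => β ^ (n + 1)) atTop (𝓝 0) :=
    (tendsto_pow_atTop_nhds_zero_of_lt_one hβ0.le hβ1).comp (tendsto_add_atTop_nat 1)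
  obtain ⟨n, hn, hn₁, hn₂⟩ := (hfreq.and_eventually
    ((hlim₁.eventually_lt_const hκ).and (hlim₂.eventually_lt_const hδ))).exists
  have hj := abs_jump_le_of_abs_sub_le hbv h (hn.trans_lt hn₂)
  have : M ^ n * |jump φ (x n)| ≤ 2 * L * β * (β * M) ^ n := by
    calc M ^ n * |jump φ (x n)| ≤ M ^ n * (2 * (L * β ^ (n + 1))) := by
          gcongr
          exact hj.trans (by gcongr)
      _ = 2 * L * β * (β * M) ^ n := by rw [mul_pow]; ring
  linarith [hlow n]

/-- A function on `[0, 1]`, extended to the line by its boundary values. -/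
noncomputable def extendUnit (φ : ℝ → ℝ) (x : ℝ) : ℝ := φ (projIcc 0 1 zero_le_one x)

theorem extendUnit_of_mem {φ : ℝ → ℝ} {x : ℝ} (hx : x ∈ Icc (0 : ℝ) 1) :
    extendUnit φ x = φ x := by
  rw [extendUnit, projIcc_of_mem _ hx]

theorem extendUnit_of_notMem {φ : ℝ → ℝ} (h : φ 0 = 0 ∧ φ 1 = 0) {x : ℝ}
    (hx : x ∉ Icc (0 : ℝ) 1) : extendUnit φ x = 0 := by
  unfold extendUnit
  rcases lt_or_ge x 0 with h0 | h0
  · rw [projIcc_of_le_left _ h0.le]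
    exact h.1
  · rw [projIcc_of_right_le _ (not_le.1 fun h1 => hx ⟨h0, h1⟩).le]
    exact h.2

theorem BoundedVariationOn.extendUnit {φ : ℝ → ℝ} (h : BoundedVariationOn φ (Icc 0 1)) :
    BoundedVariationOn (extendUnit φ) univ := by
  refine ne_top_of_le_ne_top h
    (eVariationOn.comp_le_of_monotoneOn φ (fun x => (projIcc (0 : ℝ) 1 zero_le_one x : ℝ)) ?_ ?_)
  · exact fun x _ y _ hxy => Subtype.coe_le_coe.2 (monotone_projIcc _ hxy)
  · exact fun x _ => Subtype.coe_prop _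

theorem exists_abs_extendUnit_sub_le {φ : ℝ → ℝ} {a : ℝ} (ha : a ∈ Icc (0 : ℝ) 1)
    (h : DifferentiableAt ℝ φ a) :
    ∃ L ≥ 0, ∃ δ > 0, ∀ x, |x - a| < δ → |extendUnit φ x - extendUnit φ a| ≤ L * |x - a| := by
  obtain ⟨L, hL, hO⟩ := h.isBigO_sub.exists_nonneg
  obtain ⟨δ, hδ, hball⟩ := Metric.eventually_nhds_iff.1 hO.bound
  refine ⟨L, hL, δ, hδ, fun x hx => ?_⟩
  have hp : |(projIcc (0 : ℝ) 1 zero_le_one x : ℝ) - a| ≤ |x - a| := by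
    have := abs_projIcc_sub_projIcc (h := zero_le_one (α := ℝ)) (c := x) (d := a)
    rwa [projIcc_of_mem _ ha] at this
  rw [extendUnit_of_mem ha]
  exact (hball (hp.trans_lt hx)).trans (by gcongr; exact hp)

/-- A tent function, used as a test function in the mixing estimate. -/
noncomputable def tent (x : ℝ) : ℝ := max 0 (min x (1 - x))

theorem continuous_tent : Continuous tent := by
  unfold tent
  fun_prop

theorem tent_of_notMem {x : ℝ} (hx : x ∉ Icc (0 : ℝ) 1) : tent x = 0 := by
  refine max_eq_left (min_le_iff.2 ?_)
  by_contra! h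
  exact hx ⟨h.1.le, by linarith [h.2]⟩

theorem bvOn_tent : bvOn tent := by
  have h : LipschitzWith 1 fun x : ℝ => 1 - x :=
    by
    simpa using (LipschitzWith.const (α := ℝ) (1 : ℝ)).sub LipschitzWith.id
  have h' : LipschitzWith 1 tent := by
    unfold tent
    simpa using (LipschitzWith.id.min h).const_max 0
  have := h'.locallyBoundedVariationOn (Icc 0 1) 0 1 (by simp) (by simp)
  rwa [inter_self] at this

theorem integral_tent_pos : 0 < ∫ z in Icc (0 : ℝ) 1, tent z := by
  rw [integral_Icc_eq_integral_Ioc, ← intervalIntegral.integral_of_le zero_le_one]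
  refine intervalIntegral.intervalIntegral_pos_of_pos_on
    (continuous_tent.intervalIntegrable 0 1) (fun x hx => ?_) zero_lt_one
  exact lt_max_of_lt_right (lt_min hx.1 (by linarith [hx.2]))

namespace PEUM

theorem pos_of_abs_deriv_le (P : PEUM) {M : ℝ}
    (hM : ∀ x ∈ Icc (0 : ℝ) 1, DifferentiableAt ℝ P.f x → |deriv P.f x| ≤ M) : 0 < M := by
  have hc0 := P.c_mem.1
  have hc1 := P.c_mem.2
  have hl := P.lam_gt_one
  have hex := P.expand₁ (P.c / 2) ⟨by linarith, by linarith [P.eps_pos]⟩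
  have heq : P.f =ᶠ[𝓝 (P.c / 2)] P.f₁ := by
    filter_upwards [Icc_mem_nhds (show 0 < P.c / 2 by linarith) (show P.c / 2 < P.c by linarith)]
      with x hx using P.eqOn_f₁ hx
  have hd : DifferentiableAt ℝ P.f₁ (P.c / 2) :=
    differentiableAt_of_deriv_ne_zero fun h => by rw [h, abs_zero] at hex; linarith
  have := hM (P.c / 2) ⟨by linarith, by linarith⟩ (heq.differentiableAt_iff.2 hd)
  rw [heq.deriv_eq] at this
  linarith

theorem exists_isBranch_isBranch (P : PEUM) {M : ℝ}
    (hM : ∀ x ∈ Icc (0 : ℝ) 1, DifferentiableAt ℝ P.f x → |deriv P.f x| ≤ M) :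
    ∃ s e₁ w₁ e₂ w₂, (s = 1 ∨ s = -1) ∧ P.IsBranch M 0 P.c s e₁ w₁ ∧
      P.IsBranch M P.c 1 (-s) e₂ w₂ := by
  obtain ⟨s, hs, h1, h2⟩ := P.exists_sign
  obtain ⟨e₁, w₁, h₁⟩ := P.exists_isBranch P.c_mem.1 (Icc_subset_Icc le_rfl P.c_mem.2.le) hs
    P.eqOn_f₁ P.continuousOn_deriv_f₁ h1 hM
  obtain ⟨e₂, w₂, h₂⟩ := P.exists_isBranch P.c_mem.2 (Icc_subset_Icc P.c_mem.1.le le_rfl)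
    (neg_sign hs) P.eqOn_f₂ P.continuousOn_deriv_f₂ h2 hM
  exact ⟨s, e₁, w₁, e₂, w₂, hs, h₁, h₂⟩

theorem iterate_c_mem (P : PEUM) (n : ℕ) : P.f^[n] P.c ∈ Icc (0 : ℝ) 1 :=
  P.mapsTo.iterate n (Ioo_subset_Icc_self P.c_mem)

section Branches

variable {P : PEUM} {M s : ℝ} {e₁ e₂ : ℝ ≃o ℝ} {w₁ w₂ : ℝ → ℝ}

theorem iterate_PF_of_notMem {φ : ℝ → ℝ} (h0 : ∀ x, x ∉ Icc (0 : ℝ) 1 → φ x = 0) (n : ℕ)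
    {x : ℝ} (hx : x ∉ Icc (0 : ℝ) 1) : P.PF^[n] φ x = 0 := by
  cases n with
  | zero => exact h0 x hx
  | succ n =>
    rw [Function.iterate_succ_apply']
    exact P.PF_of_notMem _ hx

theorem continuousAt_iterate_PF (hs : s = 1 ∨ s = -1) (h₁ : P.IsBranch M 0 P.c s e₁ w₁)
    (h₂ : P.IsBranch M P.c 1 (-s) e₂ w₂) {φ : ℝ → ℝ} (h0 : ∀ x, x ∉ Icc (0 : ℝ) 1 → φ x = 0)
    (hφ : Continuous φ) (n : ℕ) {y : ℝ} (hy : ∀ k, P.f^[k + 1] P.c ≠ y) :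
    ContinuousAt (P.PF^[n] φ) y := by
  induction n generalizing y with
  | zero => exact hφ.continuousAt
  | succ n ih =>
    rw [Function.iterate_succ_apply']
    refine continuousAt_PF hs h₁ h₂ (fun x hx => iterate_PF_of_notMem h0 n hx) (hy 0).symm
      fun z hz hzy => ih fun k hk => hy (k + 1) ?_
    rw [Function.iterate_succ_apply', hk, hzy]

/-- The invariant density is continuous off the critical orbit. -/
theorem continuousAt_extendUnit (hs : s = 1 ∨ s = -1) (h₁ : P.IsBranch M 0 P.c s e₁ w₁)
    (h₂ : P.IsBranch M P.c 1 (-s) e₂ w₂) {ρ : ℝ → ℝ} {θ : ℝ} (hmix : P.Mixing ρ θ)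
    (hρ : ρ 0 = 0 ∧ ρ 1 = 0) {y : ℝ} (hy : ∀ k, P.f^[k + 1] P.c ≠ y) :
    ContinuousAt (extendUnit ρ) y := by
  obtain ⟨hθ0, hθ1, C, -, hC⟩ := hmix
  have hI := integral_tent_pos
  set I := ∫ z in Icc (0 : ℝ) 1, tent z 
  have hscaled : ContinuousAt (fun x => I * extendUnit ρ x) y := by
    refine continuousAt_of_locally_uniform_approx_of_continuousAt fun u hu => ?_
    obtain ⟨ε, hε, hεu⟩ := Metric.mem_uniformity_dist.1 hu
    have hlim : Tendsto (fun n : ℕ => C * θ ^ n * bvNorm tent) atTop (𝓝 0) := by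
      simpa using ((tendsto_pow_atTop_nhds_zero_of_lt_one hθ0.le hθ1).const_mul C).mul_const
        (bvNorm tent)
    obtain ⟨n, hn⟩ := (hlim.eventually_lt_const hε).exists
    refine ⟨univ, univ_mem, P.PF^[n] tent,
      continuousAt_iterate_PF hs h₁ h₂ (fun _ => tent_of_notMem) continuous_tent n hy,
      fun x _ => hεu ?_⟩
    by_cases hx : x ∈ Icc (0 : ℝ) 1
    · rw [extendUnit_of_mem hx, dist_comm, Real.dist_eq]
      exact (hC tent bvOn_tent n x hx).trans_lt hn
    · rw [extendUnit_of_notMem hρ hx, iterate_PF_of_notMem (fun _ => tent_of_notMem) n hx]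
      simpa using hε
  refine (hscaled.const_mul I⁻¹).congr (Eventually.of_forall fun x => ?_)
  exact inv_mul_cancel_left₀ hI.ne' _

end Branches

end PEUM

/-- Lemma 4.10. For a mixing PEUM with nonperiodic critical point,
`ρ(c) > 0`, and `0 < β < 1` with `β · max|f'| < 1` (the maximum over points of
differentiability of `f`), the invariant density `ρ` is not differentiable at any point
of `𝒩_β`. -/
theorem nondifferentiable_on_Nbeta (P : PEUM) (ρ : ℝ → ℝ) (θ : ℝ)
    (hρ : P.IsInvariantDensity ρ) (hmix : P.Mixing ρ θ)
    (hnp : ∀ p : ℕ, 1 ≤ p → P.f^[p] P.c ≠ P.c)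
    (hρc : 0 < ρ P.c) (β : ℝ) (hβ0 : 0 < β) (hβ1 : β < 1)
    (hM : ∃ M : ℝ,
      (∀ x ∈ Set.Icc (0:ℝ) 1, DifferentiableAt ℝ P.f x → |deriv P.f x| ≤ M) ∧
      β * M < 1) :
    ∀ xb ∈ P.Nbeta β, ¬ DifferentiableAt ℝ ρ xb := by
  rintro xb ⟨hxb, hfreq⟩ hdiff
  obtain ⟨M, hM, hβM⟩ := hM
  have hM0 := P.pos_of_abs_deriv_le hM
  obtain ⟨s, e₁, w₁, e₂, w₂, hs, h₁, h₂⟩ := P.exists_isBranch_isBranch hM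
  obtain ⟨hbvρ, hnn, -, -, hPFρ⟩ := hρ
  have hend := PEUM.eq_zero_of_PF_eq hs h₁ h₂ hnn hPFρ
  set φ := extendUnit ρ with hφ
  have hbv : BoundedVariationOn φ univ := hbvρ.extendUnit
  have h0 : ∀ x, x ∉ Icc (0 : ℝ) 1 → φ x = 0 := fun x hx => extendUnit_of_notMem hend hx
  have hPF : ∀ y, P.PF φ y = φ y := fun y => by
    rw [P.PF_congr (fun x hx => extendUnit_of_mem hx) y]
    by_cases hy : y ∈ Icc (0 : ℝ) 1
    · rw [hPFρ y hy, hφ, extendUnit_of_mem hy]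
    · rw [P.PF_of_notMem _ hy, h0 y hy]
  have hcont : ∀ y, (∀ k, P.f^[k + 1] P.c ≠ y) → ContinuousAt φ y := fun y hy =>
    PEUM.continuousAt_extendUnit hs h₁ h₂ hmix hend hy
  set x : ℕ → ℝ := fun n => P.f^[n + 1] P.c with hxdef
  have hx : ∀ n, x (n + 1) = P.f (x n) := fun n => Function.iterate_succ_apply' _ _ _
  have hxc : ∀ n, x n ≠ P.c := fun n => hnp (n + 1) (by omega)
  have hJ0 : jump φ (x 0) ≠ 0 :=
    PEUM.jump_critical_value_ne_zero hs h₁ h₂ hM0 hbv hPF (hcont P.c hxc)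
      (by rwa [hφ, extendUnit_of_mem (Ioo_subset_Icc_self P.c_mem)])
  have hstep : ∀ n, (∀ k, x (k + 1) = x (n + 1) → x k ≠ x n → jump φ (x k) = 0) →
      |jump φ (x n)| ≤ M * |jump φ (x (n + 1))| ∧ |jump φ (x (n + 1))| ≤ |jump φ (x n)| := by
    intro n hn
    obtain ⟨w, hw, hw1, hj⟩ := PEUM.exists_abs_jump_apply_eq hs h₁ h₂ hM0 hbv h0 hPF
      (P.iterate_c_mem (n + 1)) (hxc n) fun z _ hz hzn => by
        by_cases hzo : ∃ k, x k = z
        · obtain ⟨k, rfl⟩ := hzo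
          exact hn k (by rw [hx, hx, hz]) hzn
        · push Not at hzo
          exact hbv.jump_eq (hcont z hzo).hasJump_zero
    rw [hx, hj]
    have hJ := abs_nonneg (jump φ (x n))
    refine ⟨?_, mul_le_of_le_one_right hJ hw1⟩
    calc |jump φ (x n)| = M * (|jump φ (x n)| * M⁻¹) := by field_simp
      _ ≤ M * (|jump φ (x n)| * w) := by gcongr
  obtain ⟨L, hL, δ, hδ, hlip⟩ := exists_abs_extendUnit_sub_le hxb hdiff
  have hfreq' : ∃ᶠ n in atTop, |x n - xb| ≤ β ^ (n + 1) := by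
    rw [← map_add_atTop_eq_nat 1] at hfreq
    exact hfreq
  by_cases hinj : Function.Injective x
  · exact not_forall_jump_lower_bound hbv hL hδ hM0 hβ0 hβ1 hβM (abs_pos.2 hJ0) hlip hfreq'
      (abs_le_pow_mul_of_injective (J := jump φ) hM0.le hinj hstep)
  · obtain ⟨p, hfin, hp⟩ := exists_finite_image_Ici_of_not_injective (J := jump φ) hx hinj
      (fun k => hx k ▸ PEUM.apply_ne_c hs h₁ h₂ (P.iterate_c_mem (k + 1)) (hxc k)) hJ0 hstep
    have hmem : xb ∈ x '' Ici p := by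
      refine hfin.isClosed.closure_subset (Metric.mem_closure_iff.2 fun ε hε => ?_)
      have hlim : Tendsto (fun n : ℕ => β ^ (n + 1)) atTop (𝓝 0) :=
        (tendsto_pow_atTop_nhds_zero_of_lt_one hβ0.le hβ1).comp (tendsto_add_atTop_nat 1)
      obtain ⟨n, hn, hnp', hnε⟩ := (hfreq'.and_eventually
        ((eventually_ge_atTop p).and (hlim.eventually_lt_const hε))).exists
      exact ⟨x n, mem_image_of_mem x hnp', by rw [dist_comm, Real.dist_eq]; exact hn.trans_lt hnε⟩
    obtain ⟨n, hn, hxn⟩ := hmem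
    have := abs_jump_le_of_abs_sub_le hbv hlip (y := xb) (by simpa using hδ)
    rw [sub_self, abs_zero, mul_zero, mul_zero] at this
    exact hp n hn (hxn ▸ abs_nonpos_iff.1 this)
end
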